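/- arXiv:math/0111034 — 2 statements merged into one kernel-verified Lean document; each statement's English description precedes it below -/
import Mathlib

section
/- Edge-probability update formula: let G be a finite graph with nonnegative real edge weights containing an urban-renewal patch with strictly positive weights w, x, y, z, let G' be the urban-renewed graph, and suppose M(G') > 0. Let p', q', r', s' be the probabilities that a random perfect matching of G' (chosen with probability proportional to its weight) contains the edges AB, AC, BD, CD respectively, and let p, q, r, s be the probabilities that a random perfect matching of G (chosen with probability proportional to its weight) contains the edges ab, ac, bd, cd respectively. Set Δ = 1 − p' − q' − r' − s'. Then p = s' + Δ·wz/(wz+xy), q = r' + Δ·xy/(wz+xy), r = q' + Δ·xy/(wz+xy), and s = p' + Δ·wz/(wz+xy). -/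
open scoped Classical

/-- A finset `M` of edges is a perfect matching of the graph `G` relative to the
vertex set `S`: every edge of `M` is an edge of `G`, and every vertex of `S`
belongs to exactly one edge of `M`. -/
def IsPM {V : Type} (G : SimpleGraph V) (S : Set V) (M : Finset (Sym2 V)) : Prop :=
  (∀ e ∈ M, e ∈ G.edgeSet) ∧ ∀ v ∈ S, ∃! e, e ∈ M ∧ v ∈ e

/-- `mSum G S ω` is the sum, over all perfect matchings `M` of `G` relative to the
vertex set `S`, of the product of the `ω`-weights of the edges of `M`. -/
noncomputable def mSum {V : Type} (G : SimpleGraph V) (S : Set V) (ω : Sym2 V → ℝ) : ℝ :=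
  ∑ᶠ M ∈ {M : Finset (Sym2 V) | IsPM G S M}, ∏ e ∈ M, ω e

/-- `G` together with the weights `ω` contains an urban-renewal patch on the eight
distinct vertices `A B C D a b c d`, with inner-edge weights `w x y z` and pendant
edges `aA, bB, cC, dD` of weight `1`. -/
structure UrbanPatch {V : Type} (G : SimpleGraph V) (ω : Sym2 V → ℝ)
    (A B C D a b c d : V) (w x y z : ℝ) : Prop where
  distinct : List.Pairwise (· ≠ ·) [A, B, C, D, a, b, c, d]
  adj_a : ∀ v, G.Adj a v ↔ v = b ∨ v = c ∨ v = A
  adj_b : ∀ v, G.Adj b v ↔ v = a ∨ v = d ∨ v = B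
  adj_c : ∀ v, G.Adj c v ↔ v = a ∨ v = d ∨ v = C
  adj_d : ∀ v, G.Adj d v ↔ v = b ∨ v = c ∨ v = D
  wt_ab : ω s(a, b) = w
  wt_ac : ω s(a, c) = x
  wt_bd : ω s(b, d) = y
  wt_cd : ω s(c, d) = z
  wt_aA : ω s(a, A) = 1
  wt_bB : ω s(b, B) = 1
  wt_cC : ω s(c, C) = 1
  wt_dD : ω s(d, D) = 1
  nonadj_AB : ¬ G.Adj A B
  nonadj_AC : ¬ G.Adj A C
  nonadj_AD : ¬ G.Adj A D
  nonadj_BC : ¬ G.Adj B C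
  nonadj_BD : ¬ G.Adj B D
  nonadj_CD : ¬ G.Adj C D

/-- The urban-renewed graph: delete the four inner vertices `a b c d` together with
all their incident edges, and add the four new edges `AB, AC, BD, CD`. -/
def renewGraph {V : Type} (G : SimpleGraph V) (A B C D a b c d : V) : SimpleGraph V :=
  SimpleGraph.fromRel fun u v =>
    (G.Adj u v ∧ u ∉ ({a, b, c, d} : Set V) ∧ v ∉ ({a, b, c, d} : Set V)) ∨
    (u = A ∧ v = B) ∨ (u = A ∧ v = C) ∨ (u = B ∧ v = D) ∨ (u = C ∧ v = D)

/-- The urban-renewed weights: the new edges `AB, AC, BD, CD` get weights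
`z/(wz+xy), y/(wz+xy), x/(wz+xy), w/(wz+xy)`; other edges keep their weights. -/
noncomputable def renewWeight {V : Type} (ω : Sym2 V → ℝ) (A B C D : V)
    (w x y z : ℝ) : Sym2 V → ℝ := fun e =>
  if e = s(A, B) then z / (w * z + x * y)
  else if e = s(A, C) then y / (w * z + x * y)
  else if e = s(B, D) then x / (w * z + x * y)
  else if e = s(C, D) then w / (w * z + x * y)
  else ω e


/-- `mSumP G S ω P` is the sum, over all perfect matchings `M` of `G` relative to
the vertex set `S` that moreover satisfy the predicate `P`, of the product of the
`ω`-weights of the edges of `M`. -/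
noncomputable def mSumP {V : Type} (G : SimpleGraph V) (S : Set V) (ω : Sym2 V → ℝ)
    (P : Finset (Sym2 V) → Prop) : ℝ :=
  ∑ᶠ M ∈ {M : Finset (Sym2 V) | IsPM G S M ∧ P M}, ∏ e ∈ M, ω e

/-- `edgeProb G S ω e` is the probability that a random perfect matching of `G`
(relative to the vertex set `S`, chosen with probability proportional to its
weight) contains the edge `e`. -/
noncomputable def edgeProb {V : Type} (G : SimpleGraph V) (S : Set V) (ω : Sym2 V → ℝ)
    (e : Sym2 V) : ℝ :=
  mSumP G S ω (fun M => e ∈ M) / mSum G S ω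


set_option linter.unusedSimpArgs false

/-- Matchings with edges in `E` covering exactly the complement of `Y`. -/
def PMX {V : Type} (E : Set (Sym2 V)) (Y : Set V) (M : Finset (Sym2 V)) : Prop :=
  (∀ e ∈ M, e ∈ E) ∧ ∀ v, (v ∈ Y → ∀ e ∈ M, v ∉ e) ∧ (v ∉ Y → ∃! e, e ∈ M ∧ v ∈ e)

/-- Weighted count of `PMX`. -/
noncomputable def ZX {V : Type} [Fintype V] (E : Set (Sym2 V)) (Y : Set V) (ω : Sym2 V → ℝ) : ℝ :=
  ∑ M ∈ Finset.univ.filter (fun M : Finset (Sym2 V) => PMX E Y M), ∏ e ∈ M, ω e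

/-- Weighted count of `PMX` containing the edge `f`. -/
noncomputable def ZE {V : Type} [Fintype V] (E : Set (Sym2 V)) (Y : Set V) (ω : Sym2 V → ℝ)
    (f : Sym2 V) : ℝ :=
  ∑ M ∈ Finset.univ.filter (fun M : Finset (Sym2 V) => PMX E Y M ∧ f ∈ M), ∏ e ∈ M, ω e

theorem ZX_congr {V : Type} [Fintype V] (E E' : Set (Sym2 V)) (Y Y' : Set V) (ω ω' : Sym2 V → ℝ)
    (hY : ∀ v, v ∈ Y ↔ v ∈ Y')
    (h : ∀ u v, u ∉ Y → v ∉ Y → ((s(u, v) ∈ E ↔ s(u, v) ∈ E') ∧ (s(u, v) ∈ E → ω s(u, v) = ω' s(u, v)))) :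
    ZX E Y ω = ZX E' Y' ω' := by
  obtain rfl : Y = Y' := Set.ext hY
  have key : ∀ M, PMX E Y M ↔ PMX E' Y M := by
    intro M
    unfold PMX
    refine and_congr_left fun hM => forall₂_congr fun e he => ?_
    induction e using Sym2.ind with
    | _ u v =>
      exact (h u v (fun hu => (hM u).1 hu _ he (by simp)) (fun hu => (hM v).1 hu _ he (by simp))).1
  unfold ZX
  refine Finset.sum_congr (by ext M; simp [key]) ?_
  intro M hM
  rw [Finset.mem_filter] at hM
  have hM := (key M).2 ((hM).2)
  refine Finset.prod_congr rfl fun e he => ?_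
  induction e using Sym2.ind with
  | _ u v =>
    exact (h u v (fun hu => (hM.2 u).1 hu _ he (by simp))
      (fun hu => (hM.2 v).1 hu _ he (by simp))).2 (hM.1 _ he)

theorem PMX_insert {V : Type} {E : Set (Sym2 V)} {Y : Set V} {u v : V}
    (hu : u ∉ Y) (hv : v ∉ Y) (he : s(u, v) ∈ E) {N : Finset (Sym2 V)}
    (hN : PMX E (insert u (insert v Y)) N) : PMX E Y (insert s(u, v) N) := by
  refine ⟨fun e h => ?_, fun t => ⟨fun ht e h => ?_, fun ht => ?_⟩⟩
  · rcases Finset.mem_insert.1 h with rfl | h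
    · exact he
    · exact hN.1 e h
  · rcases Finset.mem_insert.1 h with rfl | h
    · rw [Sym2.mem_iff]; rintro (rfl | rfl)
      · exact hu ht
      · exact hv ht
    · exact (hN.2 t).1 (by simp [ht]) e h
  · by_cases hc : t = u ∨ t = v
    · refine ⟨s(u, v), ⟨by simp, by simpa using hc⟩, ?_⟩
      rintro f ⟨hf, htf⟩
      rcases Finset.mem_insert.1 hf with rfl | hf
      · rfl
      · exact absurd htf ((hN.2 t).1 (by rcases hc with h | h <;> simp [h]) f hf)
    · obtain ⟨f, ⟨hf, htf⟩, huniq⟩ := (hN.2 t).2 (by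
        simp only [Set.mem_insert_iff]; tauto)
      refine ⟨f, ⟨by simp [hf], htf⟩, ?_⟩
      rintro g ⟨hg, htg⟩
      rcases Finset.mem_insert.1 hg with rfl | hg
      · exact absurd (by simpa using htg) hc
      · exact huniq g ⟨hg, htg⟩

theorem PMX_erase {V : Type} {E : Set (Sym2 V)} {Y : Set V} {u v : V}
    {M : Finset (Sym2 V)} (hu : u ∉ Y) (hv : v ∉ Y)
    (hM : PMX E Y M) (hf : s(u, v) ∈ M) : PMX E (insert u (insert v Y)) (M.erase s(u, v)) := by
  refine ⟨fun e h => hM.1 e (Finset.mem_of_mem_erase h), fun t => ⟨fun ht e h hte => ?_, fun ht => ?_⟩⟩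
  · have h1 := Finset.mem_of_mem_erase h
    have h2 := Finset.ne_of_mem_erase h
    rcases ht with rfl | rfl | ht
    · exact h2 (((hM.2 t).2 hu).unique ⟨h1, hte⟩ ⟨hf, by simp⟩)
    · exact h2 (((hM.2 t).2 hv).unique ⟨h1, hte⟩ ⟨hf, by simp⟩)
    · exact (hM.2 t).1 ht e h1 hte
  · simp only [Set.mem_insert_iff, not_or] at ht
    obtain ⟨f, ⟨hf', htf⟩, huniq⟩ := (hM.2 t).2 ht.2.2
    refine ⟨f, ⟨Finset.mem_erase.2 ⟨?_, hf'⟩, htf⟩, ?_⟩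
    · rintro rfl
      rw [Sym2.mem_iff] at htf
      tauto
    · rintro g ⟨hg, htg⟩
      exact huniq g ⟨Finset.mem_of_mem_erase hg, htg⟩

theorem ZE_eq {V : Type} [Fintype V] (E : Set (Sym2 V)) (Y : Set V) (ω : Sym2 V → ℝ) (u v : V)
    (hu : u ∉ Y) (hv : v ∉ Y) (he : s(u, v) ∈ E) :
    ZE E Y ω s(u, v) = ω s(u, v) * ZX E (insert u (insert v Y)) ω := by
  unfold ZE ZX
  rw [Finset.mul_sum]
  refine Finset.sum_bij' (fun M _ => M.erase s(u, v)) (fun N _ => insert s(u, v) N) ?_ ?_ ?_ ?_ ?_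
  · intro M hM
    simp only [Finset.mem_filter, Finset.mem_univ, true_and] at hM ⊢
    exact PMX_erase hu hv hM.1 hM.2
  · intro M hM
    simp only [Finset.mem_filter, Finset.mem_univ, true_and] at hM ⊢
    exact ⟨PMX_insert hu hv he hM, by simp⟩
  · intro M hM
    simp only [Finset.mem_filter, Finset.mem_univ, true_and] at hM
    exact Finset.insert_erase hM.2
  · intro M hM
    simp only [Finset.mem_filter, Finset.mem_univ, true_and] at hM
    exact Finset.erase_insert fun h => (hM.2 u).1 (by simp) _ h (by simp)
  · intro M hM
    simp only [Finset.mem_filter, Finset.mem_univ, true_and] at hM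
    exact (Finset.mul_prod_erase M ω hM.2).symm

theorem ZX_del {V : Type} [Fintype V] (E : Set (Sym2 V)) (Y : Set V) (ω : Sym2 V → ℝ) (u v : V)
    (hu : u ∉ Y) (hv : v ∉ Y) (he : s(u, v) ∈ E) :
    ZX E Y ω = ω s(u, v) * ZX E (insert u (insert v Y)) ω + ZX (E \ {s(u, v)}) Y ω := by
  rw [← ZE_eq E Y ω u v hu hv he]
  unfold ZX ZE
  rw [← Finset.sum_filter_add_sum_filter_not (Finset.univ.filter (fun M => PMX E Y M))
    (fun M => s(u, v) ∈ M), Finset.filter_filter, Finset.filter_filter]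
  congr 1
  refine Finset.sum_congr ?_ fun _ _ => rfl
  ext M
  simp only [Finset.mem_filter, Finset.mem_univ, true_and]
  simp only [PMX, Set.mem_sdiff, Set.mem_singleton_iff]
  constructor
  · rintro ⟨⟨h1, h2⟩, h3⟩
    exact ⟨fun e h => ⟨h1 e h, fun h' => h3 (h' ▸ h)⟩, h2⟩
  · rintro ⟨h1, h2⟩
    exact ⟨⟨fun e h => (h1 e h).1, h2⟩, fun h => (h1 _ h).2 rfl⟩

theorem ZX_vert {V : Type} [Fintype V] (E : Set (Sym2 V)) (Y : Set V) (ω : Sym2 V → ℝ) (u : V)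
    (T : Finset V) (hu : u ∉ Y) (hT : ∀ v, v ∈ T ↔ s(u, v) ∈ E ∧ v ∉ Y) :
    ZX E Y ω = ∑ v ∈ T, ω s(u, v) * ZX E (insert u (insert v Y)) ω := by
  have : ∀ v ∈ T, ω s(u, v) * ZX E (insert u (insert v Y)) ω =
      ∑ M ∈ Finset.univ.filter (fun M : Finset (Sym2 V) => PMX E Y M),
        if s(u, v) ∈ M then ∏ e ∈ M, ω e else 0 := by
    intro v hv
    rw [← ZE_eq E Y ω u v hu ((hT v).1 hv).2 ((hT v).1 hv).1, ZE, ← Finset.filter_filter,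
      Finset.sum_filter]
  rw [Finset.sum_congr rfl this, Finset.sum_comm]
  unfold ZX
  refine Finset.sum_congr rfl fun M hM => ?_
  simp only [Finset.mem_filter, Finset.mem_univ, true_and] at hM
  obtain ⟨f, ⟨hf, huf⟩, huniq⟩ := (hM.2 u).2 hu
  obtain ⟨v, rfl⟩ := Sym2.mem_iff_exists.1 huf
  rw [Finset.sum_eq_single v, if_pos hf]
  · intro t _ htv
    rw [if_neg]
    intro h
    have := huniq _ ⟨h, by simp⟩
    exact htv (Sym2.congr_right.1 this)
  · intro h
    exact absurd ((hT v).2 ⟨hM.1 _ hf, fun hv => (hM.2 v).1 hv _ hf (by simp)⟩) h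

theorem mSum_ZX {V : Type} [Fintype V] (G : SimpleGraph V) (Y : Set V) (ω : Sym2 V → ℝ)
    (h : ∀ u ∈ Y, ∀ v, ¬ G.Adj u v) :
    mSum G (Set.univ \ Y) ω = ZX G.edgeSet Y ω ∧
    ∀ f, mSumP G (Set.univ \ Y) ω (fun M => f ∈ M) = ZE G.edgeSet Y ω f := by
  have key : ∀ M, IsPM G (Set.univ \ Y) M ↔ PMX G.edgeSet Y M := by
    intro M
    unfold IsPM PMX
    refine and_congr_right fun hM => forall_congr' fun v => ?_
    constructor
    · refine fun hv => ⟨fun hY e he hve => ?_, fun hY => hv ⟨trivial, hY⟩⟩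
      obtain ⟨t, rfl⟩ := Sym2.mem_iff_exists.1 hve
      exact h v hY t (hM _ he)
    · exact fun hv hY => hv.2 hY.2
  constructor
  · unfold mSum ZX
    rw [finsum_mem_eq_finite_toFinset_sum _ (Set.toFinite _)]
    refine Finset.sum_congr ?_ fun _ _ => rfl
    ext M; simp [key]
  · intro f
    unfold mSumP ZE
    rw [finsum_mem_eq_finite_toFinset_sum _ (Set.toFinite _)]
    refine Finset.sum_congr ?_ fun _ _ => rfl
    ext M; simp [key]

theorem ZX_vert3 {V : Type} [Fintype V] (G : SimpleGraph V) (ω : Sym2 V → ℝ) (u p q r : V)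
    (h : ∀ v, G.Adj u v ↔ v = p ∨ v = q ∨ v = r) (hpq : p ≠ q) (hpr : p ≠ r) (hqr : q ≠ r)
    (Y : Set V) (hu : u ∉ Y) :
    ZX G.edgeSet Y ω =
      (if p ∈ Y then 0 else ω s(u, p) * ZX G.edgeSet (insert u (insert p Y)) ω) +
      (if q ∈ Y then 0 else ω s(u, q) * ZX G.edgeSet (insert u (insert q Y)) ω) +
      (if r ∈ Y then 0 else ω s(u, r) * ZX G.edgeSet (insert u (insert r Y)) ω) := by
  rw [ZX_vert G.edgeSet Y ω u (({p, q, r} : Finset V).filter (fun v => v ∉ Y)) hu (by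
      intro v
      simp only [Finset.mem_filter, Finset.mem_insert, Finset.mem_singleton,
        SimpleGraph.mem_edgeSet, h])]
  rw [Finset.sum_filter, Finset.sum_insert (by simp [hpq, hpr]), Finset.sum_insert (by simp [hqr]),
    Finset.sum_singleton]
  simp only [ite_not]
  ring

theorem ZX_perm {V : Type} [Fintype V] (E : Set (Sym2 V)) (ω : Sym2 V → ℝ) (Y Y' : Set V)
    (h : ∀ v, v ∈ Y ↔ v ∈ Y' := by
      intro v; simp only [Set.mem_insert_iff, Set.mem_singleton_iff, Set.mem_union,
        Set.mem_empty_iff_false, or_false, false_or, or_comm, or_left_comm, or_assoc]) :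
    ZX E Y ω = ZX E Y' ω := by
  rw [Set.ext h]

theorem patch_G {V : Type} [Fintype V]
    (G : SimpleGraph V) (ω : Sym2 V → ℝ)
    (A B C D a b c d : V) (w x y z : ℝ)
    (hp : UrbanPatch G ω A B C D a b c d w x y z) (Q : Set V → ℝ)
    (hQ : Q = fun X => ZX G.edgeSet ({a, b, c, d} ∪ X) ω) :
    ZX G.edgeSet ∅ ω = (w * z + x * y) * Q ∅ + z * Q {A, B} + w * Q {C, D} + y * Q {A, C}
      + x * Q {B, D} + Q {A, B, C, D} ∧
    ZE G.edgeSet ∅ ω s(a, b) = w * (z * Q ∅ + Q {C, D}) ∧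
    ZE G.edgeSet ∅ ω s(a, c) = x * (y * Q ∅ + Q {B, D}) ∧
    ZE G.edgeSet ∅ ω s(b, d) = y * (x * Q ∅ + Q {A, C}) ∧
    ZE G.edgeSet ∅ ω s(c, d) = z * (w * Q ∅ + Q {A, B}) := by
  subst hQ
  have hd := hp.distinct
  simp only [List.pairwise_cons, List.mem_cons, List.not_mem_nil, or_false, forall_eq_or_imp,
    forall_eq, List.Pairwise.nil, and_true, false_imp_iff, implies_true] at hd
  have hd1 := hd
  have hd2 := List.pairwise_reverse.2 (hp.distinct.imp Ne.symm)
  simp only [List.reverse_cons, List.reverse_nil, List.nil_append, List.cons_append, List.pairwise_cons, List.mem_cons, List.not_mem_nil, or_false, forall_eq_or_imp,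
    forall_eq, List.Pairwise.nil, and_true, false_imp_iff, implies_true] at hd2
  obtain ⟨⟨AB, AC, AD, Aa, Ab, Ac, Ad⟩, ⟨BC, BD, Ba, Bb, Bc, Bd⟩, ⟨CD, Ca, Cb, Cc, Cd⟩,
    ⟨Da, Db, Dc, Dd⟩, ⟨ab, ac, ad⟩, ⟨bc, bd⟩, cd⟩ := hd
  have adj_a := hp.adj_a
  have adj_b := hp.adj_b
  have adj_c := hp.adj_c
  have adj_d := hp.adj_d
  have va := ZX_vert3 G ω a b c A adj_a bc Ab.symm Ac.symm
  have vb := ZX_vert3 G ω b a d B adj_b ad Ba.symm Bd.symm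
  have vc := ZX_vert3 G ω c a d C adj_c ad Ca.symm Cd.symm
  have vd := ZX_vert3 G ω d b c D adj_d bc Db.symm Dc.symm
  rw [hp.wt_ab, hp.wt_ac, hp.wt_aA] at va
  rw [Sym2.eq_swap, hp.wt_ab, hp.wt_bd, hp.wt_bB] at vb
  rw [Sym2.eq_swap, hp.wt_ac, hp.wt_cd, hp.wt_cC] at vc
  rw [Sym2.eq_swap, hp.wt_bd, Sym2.eq_swap, hp.wt_cd, hp.wt_dD] at vd
  beta_reduce
  have h_ : ZX G.edgeSet ∅ ω =
      w * ZX G.edgeSet {a, b} ω + x * ZX G.edgeSet {a, c} ω + ZX G.edgeSet {A, a} ω := by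
    rw [va _ (by simp [hd1, hd2])]
    simp only [Set.mem_insert_iff, Set.mem_singleton_iff, Set.mem_empty_iff_false, hd1, hd2, or_false, or_true,
      true_or, if_true, if_false, zero_add, add_zero, one_mul]
    rw [ZX_perm _ _ (insert a (insert b ∅)) {a, b},
      ZX_perm _ _ (insert a (insert c ∅)) {a, c},
      ZX_perm _ _ (insert a (insert A ∅)) {A, a}]
  have h_ab : ZX G.edgeSet {a, b} ω =
      z * ZX G.edgeSet ({a, b, c, d} ∪ ∅) ω + ZX G.edgeSet {C, a, b, c} ω := by
    rw [vc _ (by simp [hd1, hd2])]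
    simp only [Set.mem_insert_iff, Set.mem_singleton_iff, Set.mem_empty_iff_false, hd1, hd2, or_false, or_true,
      true_or, if_true, if_false, zero_add, add_zero, one_mul]
    rw [ZX_perm _ _ (insert c (insert d {a, b})) ({a, b, c, d} ∪ ∅),
      ZX_perm _ _ (insert c (insert C {a, b})) {C, a, b, c}]
  have h_Cabc : ZX G.edgeSet {C, a, b, c} ω =
      ZX G.edgeSet ({a, b, c, d} ∪ {C, D}) ω := by
    rw [vd _ (by simp [hd1, hd2])]
    simp only [Set.mem_insert_iff, Set.mem_singleton_iff, Set.mem_empty_iff_false, hd1, hd2, or_false, or_true,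
      true_or, if_true, if_false, zero_add, add_zero, one_mul]
    rw [ZX_perm _ _ (insert d (insert D {C, a, b, c})) ({a, b, c, d} ∪ {C, D})]
  have h_ac : ZX G.edgeSet {a, c} ω =
      y * ZX G.edgeSet ({a, b, c, d} ∪ ∅) ω + ZX G.edgeSet {B, a, b, c} ω := by
    rw [vb _ (by simp [hd1, hd2])]
    simp only [Set.mem_insert_iff, Set.mem_singleton_iff, Set.mem_empty_iff_false, hd1, hd2, or_false, or_true,
      true_or, if_true, if_false, zero_add, add_zero, one_mul]
    rw [ZX_perm _ _ (insert b (insert d {a, c})) ({a, b, c, d} ∪ ∅),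
      ZX_perm _ _ (insert b (insert B {a, c})) {B, a, b, c}]
  have h_Babc : ZX G.edgeSet {B, a, b, c} ω =
      ZX G.edgeSet ({a, b, c, d} ∪ {B, D}) ω := by
    rw [vd _ (by simp [hd1, hd2])]
    simp only [Set.mem_insert_iff, Set.mem_singleton_iff, Set.mem_empty_iff_false, hd1, hd2, or_false, or_true,
      true_or, if_true, if_false, zero_add, add_zero, one_mul]
    rw [ZX_perm _ _ (insert d (insert D {B, a, b, c})) ({a, b, c, d} ∪ {B, D})]
  have h_Aa : ZX G.edgeSet {A, a} ω =
      y * ZX G.edgeSet {A, a, b, d} ω + ZX G.edgeSet {A, B, a, b} ω := by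
    rw [vb _ (by simp [hd1, hd2])]
    simp only [Set.mem_insert_iff, Set.mem_singleton_iff, Set.mem_empty_iff_false, hd1, hd2, or_false, or_true,
      true_or, if_true, if_false, zero_add, add_zero, one_mul]
    rw [ZX_perm _ _ (insert b (insert d {A, a})) {A, a, b, d},
      ZX_perm _ _ (insert b (insert B {A, a})) {A, B, a, b}]
  have h_Aabd : ZX G.edgeSet {A, a, b, d} ω =
      ZX G.edgeSet ({a, b, c, d} ∪ {A, C}) ω := by
    rw [vc _ (by simp [hd1, hd2])]
    simp only [Set.mem_insert_iff, Set.mem_singleton_iff, Set.mem_empty_iff_false, hd1, hd2, or_false, or_true,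
      true_or, if_true, if_false, zero_add, add_zero, one_mul]
    rw [ZX_perm _ _ (insert c (insert C {A, a, b, d})) ({a, b, c, d} ∪ {A, C})]
  have h_ABab : ZX G.edgeSet {A, B, a, b} ω =
      z * ZX G.edgeSet ({a, b, c, d} ∪ {A, B}) ω + ZX G.edgeSet {A, B, C, a, b, c} ω := by
    rw [vc _ (by simp [hd1, hd2])]
    simp only [Set.mem_insert_iff, Set.mem_singleton_iff, Set.mem_empty_iff_false, hd1, hd2, or_false, or_true,
      true_or, if_true, if_false, zero_add, add_zero, one_mul]
    rw [ZX_perm _ _ (insert c (insert d {A, B, a, b})) ({a, b, c, d} ∪ {A, B}),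
      ZX_perm _ _ (insert c (insert C {A, B, a, b})) {A, B, C, a, b, c}]
  have h_ABCabc : ZX G.edgeSet {A, B, C, a, b, c} ω =
      ZX G.edgeSet ({a, b, c, d} ∪ {A, B, C, D}) ω := by
    rw [vd _ (by simp [hd1, hd2])]
    simp only [Set.mem_insert_iff, Set.mem_singleton_iff, Set.mem_empty_iff_false, hd1, hd2, or_false, or_true,
      true_or, if_true, if_false, zero_add, add_zero, one_mul]
    rw [ZX_perm _ _ (insert d (insert D {A, B, C, a, b, c})) ({a, b, c, d} ∪ {A, B, C, D})]
  have h_bd : ZX G.edgeSet {b, d} ω =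
      x * ZX G.edgeSet ({a, b, c, d} ∪ ∅) ω + ZX G.edgeSet {A, a, b, d} ω := by
    rw [va _ (by simp [hd1, hd2])]
    simp only [Set.mem_insert_iff, Set.mem_singleton_iff, Set.mem_empty_iff_false, hd1, hd2, or_false, or_true,
      true_or, if_true, if_false, zero_add, add_zero, one_mul]
    rw [ZX_perm _ _ (insert a (insert c {b, d})) ({a, b, c, d} ∪ ∅),
      ZX_perm _ _ (insert a (insert A {b, d})) {A, a, b, d}]
  have h_cd : ZX G.edgeSet {c, d} ω =
      w * ZX G.edgeSet ({a, b, c, d} ∪ ∅) ω + ZX G.edgeSet {A, a, c, d} ω := by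
    rw [va _ (by simp [hd1, hd2])]
    simp only [Set.mem_insert_iff, Set.mem_singleton_iff, Set.mem_empty_iff_false, hd1, hd2, or_false, or_true,
      true_or, if_true, if_false, zero_add, add_zero, one_mul]
    rw [ZX_perm _ _ (insert a (insert b {c, d})) ({a, b, c, d} ∪ ∅),
      ZX_perm _ _ (insert a (insert A {c, d})) {A, a, c, d}]
  have h_Aacd : ZX G.edgeSet {A, a, c, d} ω =
      ZX G.edgeSet ({a, b, c, d} ∪ {A, B}) ω := by
    rw [vb _ (by simp [hd1, hd2])]
    simp only [Set.mem_insert_iff, Set.mem_singleton_iff, Set.mem_empty_iff_false, hd1, hd2, or_false, or_true,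
      true_or, if_true, if_false, zero_add, add_zero, one_mul]
    rw [ZX_perm _ _ (insert b (insert B {A, a, c, d})) ({a, b, c, d} ∪ {A, B})]
  have e : ∀ u v : V, (insert u (insert v ∅) : Set V) = {u, v} := by simp
  refine ⟨?_, ?_, ?_, ?_, ?_⟩
  · rw [h_]; simp only [h_ab, h_ac, h_Aa, h_bd, h_cd, h_Cabc, h_Babc, h_Aabd, h_ABab, h_Aacd, h_ABCabc]; ring
  · rw [ZE_eq G.edgeSet ∅ ω a b (by simp) (by simp)
      (by rw [SimpleGraph.mem_edgeSet, adj_a]; simp), hp.wt_ab, e]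
    simp only [h_ab, h_ac, h_Aa, h_bd, h_cd, h_Cabc, h_Babc, h_Aabd, h_ABab, h_Aacd, h_ABCabc]
  · rw [ZE_eq G.edgeSet ∅ ω a c (by simp) (by simp)
      (by rw [SimpleGraph.mem_edgeSet, adj_a]; simp), hp.wt_ac, e]
    simp only [h_ab, h_ac, h_Aa, h_bd, h_cd, h_Cabc, h_Babc, h_Aabd, h_ABab, h_Aacd, h_ABCabc]
  · rw [ZE_eq G.edgeSet ∅ ω b d (by simp) (by simp)
      (by rw [SimpleGraph.mem_edgeSet, adj_b]; simp), hp.wt_bd, e]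
    simp only [h_ab, h_ac, h_Aa, h_bd, h_cd, h_Cabc, h_Babc, h_Aabd, h_ABab, h_Aacd, h_ABCabc]
  · rw [ZE_eq G.edgeSet ∅ ω c d (by simp) (by simp)
      (by rw [SimpleGraph.mem_edgeSet, adj_c]; simp), hp.wt_cd, e]
    simp only [h_ab, h_ac, h_Aa, h_bd, h_cd, h_Cabc, h_Babc, h_Aabd, h_ABab, h_Aacd, h_ABCabc]

set_option maxHeartbeats 1000000 in
theorem patch_G' {V : Type} [Fintype V]
    (G : SimpleGraph V) (ω : Sym2 V → ℝ)
    (A B C D a b c d : V) (w x y z : ℝ)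
    (hp : UrbanPatch G ω A B C D a b c d w x y z) (Q : Set V → ℝ)
    (hQ : Q = fun X => ZX G.edgeSet ({a, b, c, d} ∪ X) ω)
    (E : Set (Sym2 V)) (hEE : E = (renewGraph G A B C D a b c d).edgeSet)
    (η : Sym2 V → ℝ) (hη : η = renewWeight ω A B C D w x y z) (Y : Set V) (hY : Y = {a, b, c, d}) :
    ZX E Y η = η s(A, B) * (η s(C, D) * Q {A, B, C, D} + Q {A, B})
      + η s(A, C) * (η s(B, D) * Q {A, B, C, D} + Q {A, C}) + η s(B, D) * Q {B, D}
      + η s(C, D) * Q {C, D} + Q ∅ ∧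
    ZE E Y η s(A, B) = η s(A, B) * (η s(C, D) * Q {A, B, C, D} + Q {A, B}) ∧
    ZE E Y η s(A, C) = η s(A, C) * (η s(B, D) * Q {A, B, C, D} + Q {A, C}) ∧
    ZE E Y η s(B, D) = η s(B, D) * (η s(A, C) * Q {A, B, C, D} + Q {B, D}) ∧
    ZE E Y η s(C, D) = η s(C, D) * (η s(A, B) * Q {A, B, C, D} + Q {C, D}) := by
  have hd1 := hp.distinct
  have hd2 := List.pairwise_reverse.2 (hp.distinct.imp Ne.symm)
  simp only [List.reverse_cons, List.reverse_nil, List.nil_append, List.cons_append,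
    List.pairwise_cons, List.mem_cons, List.not_mem_nil, or_false, forall_eq_or_imp,
    forall_eq, List.Pairwise.nil, and_true, false_imp_iff, implies_true] at hd1 hd2
  have mAB : s(A, B) ∈ E := by subst hEE; simp [renewGraph, hd1, hd2]
  have mAC : s(A, C) ∈ E := by subst hEE; simp [renewGraph, hd1, hd2]
  have mBD : s(B, D) ∈ E := by subst hEE; simp [renewGraph, hd1, hd2]
  have mCD : s(C, D) ∈ E := by subst hEE; simp [renewGraph, hd1, hd2]
  have hE : ∀ u v, u ∉ Y → v ∉ Y → (s(u, v) ∈ E ↔ G.Adj u v ∨ s(u, v) = s(A, B) ∨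
      s(u, v) = s(A, C) ∨ s(u, v) = s(B, D) ∨ s(u, v) = s(C, D)) := by
    intro u v hu hv
    subst hY hEE
    simp only [renewGraph, SimpleGraph.mem_edgeSet, SimpleGraph.fromRel_adj, hu, hv,
      not_false_eq_true, and_true, Sym2.eq_iff]
    constructor
    · rintro ⟨_, h⟩
      rw [G.adj_comm v u] at h
      clear hd1 hd2 mAB mAC mBD mCD hp
      tauto
    · intro h
      refine ⟨?_, by clear hd1 hd2 mAB mAC mBD mCD hp; tauto⟩
      rintro rfl
      have := G.loopless.irrefl u
      rcases h with h | ⟨⟨h, h'⟩ | ⟨h, h'⟩⟩ | ⟨⟨h, h'⟩ | ⟨h, h'⟩⟩ | ⟨⟨h, h'⟩ | ⟨h, h'⟩⟩ |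
        ⟨⟨h, h'⟩ | ⟨h, h'⟩⟩
      · exact this h
      all_goals (rw [h] at h'; simp [hd1, hd2] at h')
  have hN : ∀ u v, G.Adj u v → s(u, v) ≠ s(A, B) ∧ s(u, v) ≠ s(A, C) ∧ s(u, v) ≠ s(B, D) ∧
      s(u, v) ≠ s(C, D) := by
    intro u v h
    have n1 := hp.nonadj_AB
    have n2 := hp.nonadj_AC
    have n3 := hp.nonadj_BD
    have n4 := hp.nonadj_CD
    rw [← SimpleGraph.mem_edgeSet] at h n1 n2 n3 n4
    refine ⟨?_, ?_, ?_, ?_⟩ <;> (intro h'; rw [h'] at h; contradiction)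
  have K : ∀ (E' : Set (Sym2 V)) (X T : Set V), (∀ v, v ∈ T ↔ v ∈ {a, b, c, d} ∪ X) →
      (∀ e ∈ E', e ∈ E) →
      (∀ e ∈ E, e ≠ s(A, B) → e ≠ s(A, C) → e ≠ s(B, D) → e ≠ s(C, D) → e ∈ E') →
      (s(A, B) ∈ E' → A ∈ T ∨ B ∈ T) → (s(A, C) ∈ E' → A ∈ T ∨ C ∈ T) →
      (s(B, D) ∈ E' → B ∈ T ∨ D ∈ T) → (s(C, D) ∈ E' → C ∈ T ∨ D ∈ T) →
      ZX E' T η = Q X := by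
    intro E' X T hT h1 h2 hAB hAC hBD hCD
    subst hQ
    apply ZX_congr _ _ _ _ _ _ hT
    intro u v hu hv
    have hu' : u ∉ Y := fun h => hu ((hT u).2 (Or.inl (hY ▸ h)))
    have hv' : v ∉ Y := fun h => hv ((hT v).2 (Or.inl (hY ▸ h)))
    have aux : ∀ p q : V, (s(p, q) ∈ E' → p ∈ T ∨ q ∈ T) → s(u, v) ∈ E' → s(u, v) ≠ s(p, q) := by
      intro p q h he h'
      rw [h'] at he
      have := h he
      rcases Sym2.eq_iff.1 h' with ⟨rfl, rfl⟩ | ⟨rfl, rfl⟩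
      · exact this.elim hu hv
      · exact this.elim hv hu
    have r1 := aux _ _ hAB
    have r2 := aux _ _ hAC
    have r3 := aux _ _ hBD
    have r4 := aux _ _ hCD
    refine ⟨⟨fun h => ?_, fun h => ?_⟩, fun h => ?_⟩
    · have := (hE u v hu' hv').1 (h1 _ h)
      rw [SimpleGraph.mem_edgeSet]
      rcases this with g | g | g | g | g
      · exact g
      · exact absurd g (r1 h)
      · exact absurd g (r2 h)
      · exact absurd g (r3 h)
      · exact absurd g (r4 h)
    · obtain ⟨s1, s2, s3, s4⟩ := hN u v h
      exact h2 _ ((hE u v hu' hv').2 (Or.inl h)) s1 s2 s3 s4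
    · subst hη
      simp [renewWeight, r1 h, r2 h, r3 h, r4 h, -Sym2.eq]
  have hYm : ∀ v, v ∈ Y ↔ v = a ∨ v = b ∨ v = c ∨ v = d := by
    intro v; subst hY; simp
  have K' : ∀ (X T : Set V), (∀ v, v ∈ T ↔ v ∈ {a, b, c, d} ∪ X) →
      (A ∈ T ∨ B ∈ T) → (A ∈ T ∨ C ∈ T) → (B ∈ T ∨ D ∈ T) → (C ∈ T ∨ D ∈ T) →
      ZX E T η = Q X := fun X T hT h1 h2 h3 h4 => K E X T hT (fun _ h => h)
        (fun e he _ _ _ _ => he) (fun _ => h1) (fun _ => h2) (fun _ => h3) (fun _ => h4)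
  have f0 : ZX E (insert A (insert B Y)) η = η s(C, D) * Q {A, B, C, D} + Q {A, B} := by
    rw [ZX_del E (insert A (insert B Y)) η C D (by simp [hYm, hd1, hd2]) (by simp [hYm, hd1, hd2]) mCD,
      K' {A, B, C, D} (insert C (insert D (insert A (insert B Y)))) (by
      intro v; simp only [Set.mem_insert_iff, Set.mem_singleton_iff, Set.mem_union, Set.mem_empty_iff_false,
        hYm, or_false, false_or, or_comm, or_left_comm, or_assoc])
        (by simp) (by simp) (by simp) (by simp),
      K (E \ {s(C, D)}) {A, B} (insert A (insert B Y)) (by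
      intro v; simp only [Set.mem_insert_iff, Set.mem_singleton_iff, Set.mem_union, Set.mem_empty_iff_false,
        hYm, or_false, false_or, or_comm, or_left_comm, or_assoc])
        (fun e h => h.1) (fun e he h1 h2 h3 h4 => ⟨he, h4⟩)
        (by simp) (by simp) (by simp) (by simp)]
  have f1 : ZX E (insert A (insert C Y)) η = η s(B, D) * Q {A, B, C, D} + Q {A, C} := by
    rw [ZX_del E (insert A (insert C Y)) η B D (by simp [hYm, hd1, hd2]) (by simp [hYm, hd1, hd2]) mBD,
      K' {A, B, C, D} (insert B (insert D (insert A (insert C Y)))) (by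
      intro v; simp only [Set.mem_insert_iff, Set.mem_singleton_iff, Set.mem_union, Set.mem_empty_iff_false,
        hYm, or_false, false_or, or_comm, or_left_comm, or_assoc])
        (by simp) (by simp) (by simp) (by simp),
      K (E \ {s(B, D)}) {A, C} (insert A (insert C Y)) (by
      intro v; simp only [Set.mem_insert_iff, Set.mem_singleton_iff, Set.mem_union, Set.mem_empty_iff_false,
        hYm, or_false, false_or, or_comm, or_left_comm, or_assoc])
        (fun e h => h.1) (fun e he h1 h2 h3 h4 => ⟨he, h3⟩)
        (by simp) (by simp) (by simp) (by simp)]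
  have f2 : ZX E (insert B (insert D Y)) η = η s(A, C) * Q {A, B, C, D} + Q {B, D} := by
    rw [ZX_del E (insert B (insert D Y)) η A C (by simp [hYm, hd1, hd2]) (by simp [hYm, hd1, hd2]) mAC,
      K' {A, B, C, D} (insert A (insert C (insert B (insert D Y)))) (by
      intro v; simp only [Set.mem_insert_iff, Set.mem_singleton_iff, Set.mem_union, Set.mem_empty_iff_false,
        hYm, or_false, false_or, or_comm, or_left_comm, or_assoc])
        (by simp) (by simp) (by simp) (by simp),
      K (E \ {s(A, C)}) {B, D} (insert B (insert D Y)) (by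
      intro v; simp only [Set.mem_insert_iff, Set.mem_singleton_iff, Set.mem_union, Set.mem_empty_iff_false,
        hYm, or_false, false_or, or_comm, or_left_comm, or_assoc])
        (fun e h => h.1) (fun e he h1 h2 h3 h4 => ⟨he, h2⟩)
        (by simp) (by simp) (by simp) (by simp)]
  have f3 : ZX E (insert C (insert D Y)) η = η s(A, B) * Q {A, B, C, D} + Q {C, D} := by
    rw [ZX_del E (insert C (insert D Y)) η A B (by simp [hYm, hd1, hd2]) (by simp [hYm, hd1, hd2]) mAB,
      K' {A, B, C, D} (insert A (insert B (insert C (insert D Y)))) (by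
      intro v; simp only [Set.mem_insert_iff, Set.mem_singleton_iff, Set.mem_union, Set.mem_empty_iff_false,
        hYm, or_false, false_or, or_comm, or_left_comm, or_assoc])
        (by simp) (by simp) (by simp) (by simp),
      K (E \ {s(A, B)}) {C, D} (insert C (insert D Y)) (by
      intro v; simp only [Set.mem_insert_iff, Set.mem_singleton_iff, Set.mem_union, Set.mem_empty_iff_false,
        hYm, or_false, false_or, or_comm, or_left_comm, or_assoc])
        (fun e h => h.1) (fun e he h1 h2 h3 h4 => ⟨he, h1⟩)
        (by simp) (by simp) (by simp) (by simp)]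
  have g1 : ZX (E \ {s(A, B)}) (insert A (insert C Y)) η = ZX E (insert A (insert C Y)) η := by
    apply ZX_congr
    · simp
    · intro u v hu hv
      simp only [Set.mem_sdiff, Set.mem_singleton_iff, implies_true, and_true, and_iff_left_iff_imp]
      intro _ h
      rcases Sym2.eq_iff.1 h with ⟨rfl, rfl⟩ | ⟨rfl, rfl⟩ <;> simp at hu hv
  refine ⟨?_, ?_, ?_, ?_, ?_⟩
  · rw [ZX_del E Y η A B (by simp [hYm, hd1, hd2]) (by simp [hYm, hd1, hd2]) mAB, f0,
      ZX_del (E \ {s(A, B)}) Y η A C (by simp [hYm, hd1, hd2]) (by simp [hYm, hd1, hd2]) (by simp [mAC, hd1, hd2]), g1, f1,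
      ZX_del ((E \ {s(A, B)}) \ {s(A, C)}) Y η B D (by simp [hYm, hd1, hd2]) (by simp [hYm, hd1, hd2]) (by simp [mBD, hd1, hd2]),
      ZX_del (((E \ {s(A, B)}) \ {s(A, C)}) \ {s(B, D)}) Y η C D (by simp [hYm, hd1, hd2]) (by simp [hYm, hd1, hd2]) (by simp [mCD, hd1, hd2]),
      K ((E \ {s(A, B)}) \ {s(A, C)}) {B, D} (insert B (insert D Y)) (by
      intro v; simp only [Set.mem_insert_iff, Set.mem_singleton_iff, Set.mem_union, Set.mem_empty_iff_false,
        hYm, or_false, false_or, or_comm, or_left_comm, or_assoc])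
        (by simp +contextual) (by simp +contextual) (by simp [hd1, hd2]) (by simp [hd1, hd2])
        (by simp [hd1, hd2]) (by simp [hd1, hd2]),
      K (((E \ {s(A, B)}) \ {s(A, C)}) \ {s(B, D)}) {C, D} (insert C (insert D Y)) (by
      intro v; simp only [Set.mem_insert_iff, Set.mem_singleton_iff, Set.mem_union, Set.mem_empty_iff_false,
        hYm, or_false, false_or, or_comm, or_left_comm, or_assoc])
        (by simp +contextual) (by simp +contextual) (by simp [hd1, hd2]) (by simp [hd1, hd2])
        (by simp [hd1, hd2]) (by simp [hd1, hd2]),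
      K ((((E \ {s(A, B)}) \ {s(A, C)}) \ {s(B, D)}) \ {s(C, D)}) ∅ Y (by
      intro v; simp only [Set.mem_insert_iff, Set.mem_singleton_iff, Set.mem_union, Set.mem_empty_iff_false,
        hYm, or_false, false_or, or_comm, or_left_comm, or_assoc])
        (by simp +contextual) (by simp +contextual) (by simp [hd1, hd2]) (by simp [hd1, hd2])
        (by simp [hd1, hd2]) (by simp [hd1, hd2])]
    ring
  · rw [ZE_eq E Y η A B (by simp [hYm, hd1, hd2]) (by simp [hYm, hd1, hd2]) mAB, f0]
  · rw [ZE_eq E Y η A C (by simp [hYm, hd1, hd2]) (by simp [hYm, hd1, hd2]) mAC, f1]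
  · rw [ZE_eq E Y η B D (by simp [hYm, hd1, hd2]) (by simp [hYm, hd1, hd2]) mBD, f2]
  · rw [ZE_eq E Y η C D (by simp [hYm, hd1, hd2]) (by simp [hYm, hd1, hd2]) mCD, f3]

/-- **Edge-probability update formula**: with `p', q', r', s'` the inclusion
probabilities of the edges `AB, AC, BD, CD` in the urban-renewed graph `G'`,
`p, q, r, s` the inclusion probabilities of the edges `ab, ac, bd, cd` in `G`,
and `Δ = 1 − p' − q' − r' − s'`, one has `p = s' + Δ·wz/(wz+xy)`,
`q = r' + Δ·xy/(wz+xy)`, `r = q' + Δ·xy/(wz+xy)`, `s = p' + Δ·wz/(wz+xy)`. -/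
theorem urban_renewal_edge_probabilities {V : Type} [Fintype V]
    (G : SimpleGraph V) (ω : Sym2 V → ℝ)
    (A B C D a b c d : V) (w x y z : ℝ)
    (hnonneg : ∀ e ∈ G.edgeSet, 0 ≤ ω e)
    (hpatch : UrbanPatch G ω A B C D a b c d w x y z)
    (hw : 0 < w) (hx : 0 < x) (hy : 0 < y) (hz : 0 < z)
    (hpos : 0 < mSum (renewGraph G A B C D a b c d) (Set.univ \ {a, b, c, d})
      (renewWeight ω A B C D w x y z)) :
    edgeProb G Set.univ ω s(a, b)
        = edgeProb (renewGraph G A B C D a b c d) (Set.univ \ {a, b, c, d})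
            (renewWeight ω A B C D w x y z) s(C, D)
          + (1 - edgeProb (renewGraph G A B C D a b c d) (Set.univ \ {a, b, c, d})
                  (renewWeight ω A B C D w x y z) s(A, B)
               - edgeProb (renewGraph G A B C D a b c d) (Set.univ \ {a, b, c, d})
                  (renewWeight ω A B C D w x y z) s(A, C)
               - edgeProb (renewGraph G A B C D a b c d) (Set.univ \ {a, b, c, d})
                  (renewWeight ω A B C D w x y z) s(B, D)
               - edgeProb (renewGraph G A B C D a b c d) (Set.univ \ {a, b, c, d})
                  (renewWeight ω A B C D w x y z) s(C, D))
            * (w * z / (w * z + x * y)) ∧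
    edgeProb G Set.univ ω s(a, c)
        = edgeProb (renewGraph G A B C D a b c d) (Set.univ \ {a, b, c, d})
            (renewWeight ω A B C D w x y z) s(B, D)
          + (1 - edgeProb (renewGraph G A B C D a b c d) (Set.univ \ {a, b, c, d})
                  (renewWeight ω A B C D w x y z) s(A, B)
               - edgeProb (renewGraph G A B C D a b c d) (Set.univ \ {a, b, c, d})
                  (renewWeight ω A B C D w x y z) s(A, C)
               - edgeProb (renewGraph G A B C D a b c d) (Set.univ \ {a, b, c, d})
                  (renewWeight ω A B C D w x y z) s(B, D)
               - edgeProb (renewGraph G A B C D a b c d) (Set.univ \ {a, b, c, d})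
                  (renewWeight ω A B C D w x y z) s(C, D))
            * (x * y / (w * z + x * y)) ∧
    edgeProb G Set.univ ω s(b, d)
        = edgeProb (renewGraph G A B C D a b c d) (Set.univ \ {a, b, c, d})
            (renewWeight ω A B C D w x y z) s(A, C)
          + (1 - edgeProb (renewGraph G A B C D a b c d) (Set.univ \ {a, b, c, d})
                  (renewWeight ω A B C D w x y z) s(A, B)
               - edgeProb (renewGraph G A B C D a b c d) (Set.univ \ {a, b, c, d})
                  (renewWeight ω A B C D w x y z) s(A, C)
               - edgeProb (renewGraph G A B C D a b c d) (Set.univ \ {a, b, c, d})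
                  (renewWeight ω A B C D w x y z) s(B, D)
               - edgeProb (renewGraph G A B C D a b c d) (Set.univ \ {a, b, c, d})
                  (renewWeight ω A B C D w x y z) s(C, D))
            * (x * y / (w * z + x * y)) ∧
    edgeProb G Set.univ ω s(c, d)
        = edgeProb (renewGraph G A B C D a b c d) (Set.univ \ {a, b, c, d})
            (renewWeight ω A B C D w x y z) s(A, B)
          + (1 - edgeProb (renewGraph G A B C D a b c d) (Set.univ \ {a, b, c, d})
                  (renewWeight ω A B C D w x y z) s(A, B)
               - edgeProb (renewGraph G A B C D a b c d) (Set.univ \ {a, b, c, d})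
                  (renewWeight ω A B C D w x y z) s(A, C)
               - edgeProb (renewGraph G A B C D a b c d) (Set.univ \ {a, b, c, d})
                  (renewWeight ω A B C D w x y z) s(B, D)
               - edgeProb (renewGraph G A B C D a b c d) (Set.univ \ {a, b, c, d})
                  (renewWeight ω A B C D w x y z) s(C, D))
            * (w * z / (w * z + x * y)) := by
  have hd1 := hpatch.distinct
  simp only [List.pairwise_cons, List.mem_cons, List.not_mem_nil, or_false, forall_eq_or_imp,
    forall_eq, List.Pairwise.nil, and_true, false_imp_iff, implies_true, ne_eq] at hd1
  obtain ⟨s0, sE⟩ := mSum_ZX G ∅ ω (by simp)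
  rw [Set.sdiff_empty] at s0 sE
  obtain ⟨s0', sE'⟩ := mSum_ZX (renewGraph G A B C D a b c d) {a, b, c, d}
    (renewWeight ω A B C D w x y z) (by
      intro u hu v h
      simp only [renewGraph, SimpleGraph.fromRel_adj, hu, not_true_eq_false, false_and, and_false,
        false_or] at h
      simp only [Set.mem_insert_iff, Set.mem_singleton_iff] at hu
      grind)
  obtain ⟨t0, t1, t2, t3, t4⟩ := patch_G G ω A B C D a b c d w x y z hpatch _ rfl
  obtain ⟨u0, u1, u2, u3, u4⟩ := patch_G' G ω A B C D a b c d w x y z hpatch _ rfl _ rfl _ rfl _ rfl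
  have e1 : renewWeight ω A B C D w x y z s(A, B) = z / (w * z + x * y) := by
    simp [renewWeight]
  have e2 : renewWeight ω A B C D w x y z s(A, C) = y / (w * z + x * y) := by
    rw [renewWeight, if_neg (by rw [Sym2.eq_iff]; grind), if_pos rfl]
  have e3 : renewWeight ω A B C D w x y z s(B, D) = x / (w * z + x * y) := by
    rw [renewWeight, if_neg (by rw [Sym2.eq_iff]; grind), if_neg (by rw [Sym2.eq_iff]; grind),
      if_pos rfl]
  have e4 : renewWeight ω A B C D w x y z s(C, D) = w / (w * z + x * y) := by
    rw [renewWeight, if_neg (by rw [Sym2.eq_iff]; grind), if_neg (by rw [Sym2.eq_iff]; grind),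
      if_neg (by rw [Sym2.eq_iff]; grind), if_pos rfl]
  rw [s0', u0] at hpos
  unfold edgeProb
  simp only [s0, s0', sE, sE', t0, t1, t2, t3, t4, u0, u1, u2, u3, u4]
  rw [e1, e2, e3, e4] at hpos ⊢
  beta_reduce at hpos ⊢
  generalize ZX G.edgeSet ({a, b, c, d} ∪ ∅) ω = Q0 at *
  generalize ZX G.edgeSet ({a, b, c, d} ∪ {A, B, C, D}) ω = Q5 at *
  generalize ZX G.edgeSet ({a, b, c, d} ∪ {A, B}) ω = Q1 at *
  generalize ZX G.edgeSet ({a, b, c, d} ∪ {A, C}) ω = Q2 at *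
  generalize ZX G.edgeSet ({a, b, c, d} ∪ {B, D}) ω = Q3 at *
  generalize ZX G.edgeSet ({a, b, c, d} ∪ {C, D}) ω = Q4 at *
  clear * - hw hx hy hz hpos
  have hK : 0 < w * z + x * y := by positivity
  generalize hk : w * z + x * y = k at *
  have hM : z / k * (w / k * Q5 + Q1) + y / k * (x / k * Q5 + Q2) + x / k * Q3 + w / k * Q4 + Q0
      = (k * Q0 + z * Q1 + w * Q4 + y * Q2 + x * Q3 + Q5) / k := by
    field_simp
    linear_combination Q5 * hk
  rw [hM] at hpos ⊢
  have hN : 0 < k * Q0 + z * Q1 + w * Q4 + y * Q2 + x * Q3 + Q5 := by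
    have := mul_pos hpos hK
    rwa [div_mul_cancel₀ _ hK.ne'] at this
  generalize hm : k * Q0 + z * Q1 + w * Q4 + y * Q2 + x * Q3 + Q5 = m at *
  refine ⟨?_, ?_, ?_, ?_⟩
  · field_simp
    subst hm
    linear_combination (2 * z * Q5) * hk
  · field_simp
    subst hm
    linear_combination (2 * y * Q5) * hk
  · field_simp
    subst hm
    linear_combination (2 * x * Q5) * hk
  · field_simp
    subst hm
    linear_combination (2 * w * Q5) * hk
end

section
/- Yang's fortress theorem: for every n ≥ 1 and either of the two alternating colorings, the number of perfect matchings of the fortress graph of order n is either a power of 5 or twice a power of 5; that is, there exists a natural number k such that the number of perfect matchings equals 5^k or 2·5^k. -/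
/-- A triangle of the cut-up `n × n` array of unit squares: a square position in
`Fin n × Fin n` together with a direction in `Fin 4` (`0` = north triangle,
`1` = east, `2` = south, `3` = west; each unit square is cut by its two diagonals
into these four isosceles right triangles). -/
abbrev Tri (n : ℕ) := (Fin n × Fin n) × Fin 4

/-- The alternating coloring of the triangles (with `ε` selecting one of the two
such colorings): triangles sharing a side receive different colors; `true` is
interpreted as black. -/
def triColor {n : ℕ} (ε : Bool) (t : Tri n) : Bool :=
  xor ε (xor (decide ((((t.1.1 : ℕ) + (t.1.2 : ℕ)) % 2) = 0))
    (decide (t.2 = 1 ∨ t.2 = 3)))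

/-- The triangle `t` is removed when forming the fortress: it is black with an
edge on the top or bottom boundary of the array, or white with an edge on the
left or right boundary.  (A triangle has an edge on the boundary exactly when its
hypotenuse lies on it.) -/
def removed {n : ℕ} (ε : Bool) (t : Tri n) : Prop :=
  (triColor ε t = true ∧
    ((t.2 = 0 ∧ (t.1.2 : ℕ) = n - 1) ∨ (t.2 = 2 ∧ (t.1.2 : ℕ) = 0))) ∨
  (triColor ε t = false ∧
    ((t.2 = 3 ∧ (t.1.1 : ℕ) = 0) ∨ (t.2 = 1 ∧ (t.1.1 : ℕ) = n - 1)))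

/-- Two triangles of the cut-up array share a side: either they lie in the same
square and their directions are cyclically adjacent (sharing a leg), or they lie
in horizontally (resp. vertically) adjacent squares and are the east/west
(resp. north/south) pair sharing the common hypotenuse. -/
def triRel {n : ℕ} (t t' : Tri n) : Prop :=
  (t.1 = t'.1 ∧
    ((t.2 = 0 ∧ t'.2 = 1) ∨ (t.2 = 1 ∧ t'.2 = 2) ∨
     (t.2 = 2 ∧ t'.2 = 3) ∨ (t.2 = 3 ∧ t'.2 = 0))) ∨
  (t.2 = 1 ∧ t'.2 = 3 ∧ (t'.1.1 : ℕ) = (t.1.1 : ℕ) + 1 ∧ t.1.2 = t'.1.2) ∨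
  (t.2 = 0 ∧ t'.2 = 2 ∧ (t'.1.2 : ℕ) = (t.1.2 : ℕ) + 1 ∧ t.1.1 = t'.1.1)

/-- The fortress graph of order `n` (for the coloring selected by `ε`): vertices
are the non-removed triangles, with an edge between two triangles exactly when
they share a side. -/
def fortressGraph (n : ℕ) (ε : Bool) : SimpleGraph (Tri n) :=
  SimpleGraph.fromRel fun t t' => triRel t t' ∧ ¬ removed ε t ∧ ¬ removed ε t'


namespace Fort
open Finset

abbrev Bk (n : ℕ) := Fin n × Fin n

/-- extension of a block-indexed function by an outside value -/
def ext {α : Type} {n : ℕ} (v : Bk n → Fin 4 → α) (o : ℤ → ℤ → α) (i j : ℤ) (d : Fin 4) : α :=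
  if h : (0 ≤ i ∧ i < n) ∧ (0 ≤ j ∧ j < n) then
    v (⟨i.toNat, by omega⟩, ⟨j.toNat, by omega⟩) d else o i j

def dx : Fin 4 → ℤ := ![0, 1, 0, -1]
def dy : Fin 4 → ℤ := ![1, 0, -1, 0]

lemma ext_in {α : Type} {n : ℕ} (v : Bk n → Fin 4 → α) (o : ℤ → ℤ → α) (b : Bk n) (d : Fin 4) :
    ext v o (b.1 : ℕ) (b.2 : ℕ) d = v b d := by
  have h1 := b.1.2
  have h2 := b.2.2
  unfold ext
  rw [dif_pos (by omega)]
  congr 1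

lemma ext_in' {α : Type} {n : ℕ} (v : Bk n → Fin 4 → α) (o : ℤ → ℤ → α) {i j : ℤ} (b : Bk n)
    (d : Fin 4) (hi : (b.1 : ℕ) = i) (hj : (b.2 : ℕ) = j) :
    ext v o i j d = v b d := by
  subst hi hj; exact ext_in v o b d

lemma ext_out {α : Type} {n : ℕ} (v : Bk n → Fin 4 → α) (o : ℤ → ℤ → α) {i j : ℤ} (d : Fin 4)
    (h : ¬ ((0 ≤ i ∧ i < n) ∧ (0 ≤ j ∧ j < n))) : ext v o i j d = o i j := by
  unfold ext; rw [dif_neg h]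

lemma exists_bk {n : ℕ} {i j : ℤ} (h : (0 ≤ i ∧ i < n) ∧ (0 ≤ j ∧ j < n)) :
    ∃ b : Bk n, (b.1 : ℕ) = i ∧ (b.2 : ℕ) = j :=
  ⟨(⟨i.toNat, by omega⟩, ⟨j.toNat, by omega⟩), by simp; omega, by simp; omega⟩

def Cond (n : ℕ) (R : ℕ → ℕ → Prop) (v : Bk n → Fin 4 → ℕ) (o : ℤ → ℤ → ℕ) : Prop :=
  ∀ (b : Bk n) (d : Fin 4), R (v b d) (ext v o ((b.1 : ℕ) + dx d) ((b.2 : ℕ) + dy d) (d + 2))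

lemma cond_iff (n : ℕ) (R : ℕ → ℕ → Prop) (hs : ∀ a b, R a b → R b a)
    (v : Bk n → Fin 4 → ℕ) (o : ℤ → ℤ → ℕ) : Cond n R v o ↔
    ∀ i j : ℤ, 0 ≤ i → i < n → 0 ≤ j → j ≤ n →
      R (ext v o i (j-1) 0) (ext v o i j 2) ∧ R (ext v o (j-1) i 1) (ext v o j i 3) := by
  constructor
  · intro h i j hi hi' hj hj'
    constructor
    · by_cases hjn : j < n
      · obtain ⟨b, h1, h2⟩ := exists_bk (n := n) (i := i) (j := j) (by omega)
        have := h b 2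
        rw [← ext_in v o b, h1, h2] at this
        simp [dx, dy] at this
        exact hs _ _ this
      · obtain ⟨b, h1, h2⟩ := exists_bk (n := n) (i := i) (j := j-1) (by omega)
        have := h b 0
        rw [← ext_in v o b, h1, h2] at this
        simp [dx, dy] at this
        exact this
    · by_cases hjn : j < n
      · obtain ⟨b, h1, h2⟩ := exists_bk (n := n) (i := j) (j := i) (by omega)
        have := h b 3
        rw [← ext_in v o b, h1, h2] at this
        simp [dx, dy] at this
        exact hs _ _ this
      · obtain ⟨b, h1, h2⟩ := exists_bk (n := n) (i := j-1) (j := i) (by omega)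
        have := h b 1
        rw [← ext_in v o b, h1, h2] at this
        simp [dx, dy] at this
        exact this
  · intro h b d
    rw [← ext_in v o b]
    have h1 := b.1.2
    have h2 := b.2.2
    fin_cases d
    · have := (h (b.1 : ℕ) ((b.2 : ℕ) + 1) (by omega) (by omega) (by omega) (by omega)).1
      simpa [dx, dy] using this
    · have := (h (b.2 : ℕ) ((b.1 : ℕ) + 1) (by omega) (by omega) (by omega) (by omega)).2
      simpa [dx, dy] using this
    · have := (h (b.1 : ℕ) ((b.2 : ℕ)) (by omega) (by omega) (by omega) (by omega)).1
      simpa [dx, dy, sub_eq_add_neg] using hs _ _ this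
    · have := (h (b.2 : ℕ) ((b.1 : ℕ)) (by omega) (by omega) (by omega) (by omega)).2
      simpa [dx, dy, sub_eq_add_neg] using hs _ _ this

def st (x : Fin 4 → Bool) (d : Fin 4) : ℕ := (x d).toNat + (x (d + 3)).toNat

def wt (w : Fin 4 → ℚ) (x : Fin 4 → Bool) : ℚ := ∏ d, if x d then w d else 1

open Classical in
noncomputable def f (w : Fin 4 → ℚ) (u : Fin 4 → Bool) : ℚ :=
  ∑ x : Fin 4 → Bool, if (∀ d, st x d = (u d).toNat) then wt w x else 0

def tn {β : Type} (u : β → Fin 4 → Bool) : β → Fin 4 → ℕ := fun b d => (u b d).toNat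

open Classical in
noncomputable def P (n : ℕ) (R : ℕ → ℕ → Prop) (o : ℤ → ℤ → Bool) (w : Bk n → Fin 4 → ℚ) : ℚ :=
  ∑ u : Bk n → Fin 4 → Bool,
    if Cond n R (tn u) (fun i j => (o i j).toNat) then ∏ b, f (w b) (u b) else 0

open Classical in
lemma P_eq_X (n : ℕ) (R : ℕ → ℕ → Prop) (hR : ∀ a b, R a b → a ≤ 1) (o : ℤ → ℤ → Bool)
    (w : Bk n → Fin 4 → ℚ) : P n R o w =
    ∑ X : Bk n → Fin 4 → Bool,
      if Cond n R (fun b => st (X b)) (fun i j => (o i j).toNat) then ∏ b, wt (w b) (X b) else 0 := by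
  unfold P f
  simp_rw [Finset.prod_univ_sum, Fintype.piFinset_univ]
  simp_rw [← Finset.sum_filter (s := (univ : Finset (Bk n → Fin 4 → Bool)))]
  rw [Finset.sum_comm, Finset.sum_filter]
  refine Finset.sum_congr rfl fun X _ => ?_
  split_ifs with h
  · have h1 : ∀ b d, st (X b) d ≤ 1 := fun b d => hR _ _ (h b d)
    have h2 : tn (fun b d => decide (st (X b) d = 1)) = fun b => st (X b) := by
      funext b d
      have := h1 b d
      unfold tn
      by_cases h3 : st (X b) d = 1
      · simp [h3]
      · have : st (X b) d = 0 := by omega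
        simp [this]
    rw [Finset.sum_eq_single_of_mem (fun b d => decide (st (X b) d = 1))]
    · refine Finset.prod_congr rfl fun b _ => ?_
      rw [if_pos]
      intro d
      exact (congrFun (congrFun h2 b) d).symm
    · simp only [mem_filter, mem_univ, true_and]
      rw [h2]; exact h
    · intro u _ hu
      by_contra hne
      apply hu
      have : ∀ b, ∀ d, st (X b) d = (u b d).toNat := by
        intro b
        by_contra hb
        exact hne (Finset.prod_eq_zero (mem_univ b) (if_neg hb))
      funext b d
      rw [this b d]
      cases u b d <;> simp
  · refine Finset.sum_eq_zero fun u hu => ?_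
    simp only [mem_filter, mem_univ, true_and] at hu
    by_contra hne
    apply h
    have : ∀ b, ∀ d, st (X b) d = (u b d).toNat := by
      intro b
      by_contra hb
      exact hne (Finset.prod_eq_zero (mem_univ b) (if_neg hb))
    have : (fun b => st (X b)) = tn u := by
      funext b d; exact this b d
    rw [this]; exact hu

/-! ### flips -/

def flip (s : Bool) (u : Fin 4 → Bool) : Fin 4 → Bool := fun d => xor s (u d)

lemma ext_map {α γ : Type} {n : ℕ} (v : Bk n → Fin 4 → α) (o : ℤ → ℤ → α) (F : ℤ → ℤ → α → γ)
    (i j : ℤ) (d : Fin 4) :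
    ext (fun (b : Bk n) d => F (b.1 : ℕ) (b.2 : ℕ) (v b d)) (fun i j => F i j (o i j)) i j d
      = F i j (ext v o i j d) := by
  by_cases h : (0 ≤ i ∧ i < n) ∧ (0 ≤ j ∧ j < n)
  · obtain ⟨b, h1, h2⟩ := exists_bk h
    rw [ext_in' _ _ b d h1 h2, ext_in' _ _ b d h1 h2, h1, h2]
  · rw [ext_out _ _ _ h, ext_out _ _ _ h]

lemma P_flip (n : ℕ) (R R' : ℕ → ℕ → Prop) (o : ℤ → ℤ → Bool) (s : ℤ → ℤ → Bool)
    (w w' : Bk n → Fin 4 → ℚ) (c : Bk n → ℚ)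
    (hR : ∀ (i j : ℤ) (d : Fin 4) (p q : Bool), R p.toNat q.toNat ↔
      R' (xor (s i j) p).toNat (xor (s (i + dx d) (j + dy d)) q).toNat)
    (hf : ∀ (b : Bk n) u, f (w b) u = c b * f (w' b) (flip (s (b.1 : ℕ) (b.2 : ℕ)) u)) :
    P n R o w = (∏ b, c b) * P n R' (fun i j => xor (s i j) (o i j)) w' := by
  classical
  unfold P
  rw [Finset.mul_sum]
  let e : (Bk n → Fin 4 → Bool) ≃ (Bk n → Fin 4 → Bool) :=
    { toFun := fun u b => flip (s (b.1 : ℕ) (b.2 : ℕ)) (u b)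
      invFun := fun u b => flip (s (b.1 : ℕ) (b.2 : ℕ)) (u b)
      left_inv := fun u => by funext b d; simp [flip]
      right_inv := fun u => by funext b d; simp [flip] }
  refine Fintype.sum_equiv e _ _ fun u => ?_
  have key : Cond n R (tn u) (fun i j => (o i j).toNat) ↔
      Cond n R' (tn (e u)) (fun i j => (xor (s i j) (o i j)).toNat) := by
    unfold Cond
    refine forall_congr' fun b => forall_congr' fun d => ?_
    have h1 := fun i j => ext_map u o (fun _ _ x => x.toNat) i j (d+2)
    have h2 := fun i j => ext_map u o (fun i j x => (xor (s i j) x).toNat) i j (d+2)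
    unfold tn
    rw [h1]
    erw [h2]
    rw [hR]
    rfl
  simp only [key]
  split_ifs
  · rw [← Finset.prod_mul_distrib]
    exact Finset.prod_congr rfl fun b _ => hf b _
  · simp

lemma sum_cfg (g : (Fin 4 → Bool) → ℚ) : ∑ x, g x =
    ∑ a : Bool, ∑ b : Bool, ∑ c : Bool, ∑ d : Bool, g ![a, b, c, d] := by
  let e : (Fin 4 → Bool) ≃ Bool × Bool × Bool × Bool :=
    { toFun := fun x => (x 0, x 1, x 2, x 3)
      invFun := fun y => ![y.1, y.2.1, y.2.2.1, y.2.2.2]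
      left_inv := fun x => by funext d; fin_cases d <;> rfl
      right_inv := fun y => rfl }
  rw [Fintype.sum_equiv e g (fun y => g (e.symm y)) (fun x => by simp)]
  simp only [Fintype.sum_prod_type]
  rfl

def fv (w : Fin 4 → ℚ) : Bool → Bool → Bool → Bool → ℚ
  | false, false, false, false => 1
  | true, true, true, true => w 0 * w 2 + w 1 * w 3
  | true, true, false, false => w 0
  | false, true, true, false => w 1
  | false, false, true, true => w 2
  | true, false, false, true => w 3
  | _, _, _, _ => 0

lemma f_eq (w : Fin 4 → ℚ) (u : Fin 4 → Bool) : f w u = fv w (u 0) (u 1) (u 2) (u 3) := by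
  unfold f
  rw [sum_cfg]
  simp only [Fin.forall_fin_succ, st, wt, Fin.prod_univ_four, Fintype.sum_bool]
  generalize h0 : u 0 = a
  generalize h1 : u 1 = b
  generalize h2 : u 2 = c
  generalize h3 : u 3 = d
  cases a <;> cases b <;> cases c <;> cases d <;> simp [h1, h2, h3, fv]

lemma f_compl (w w' : Fin 4 → ℚ) (D : ℚ) (hD : D = w 0 * w 2 + w 1 * w 3) (hD0 : D ≠ 0)
    (hw : ∀ d, w' d = w (d + 2) / D) (u : Fin 4 → Bool) : f w u = D * f w' (flip true u) := by
  rw [f_eq, f_eq]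
  have h0 := hw 0
  have h1 := hw 1
  have h2 := hw 2
  have h3 := hw 3
  have e0 : (0 + 2 : Fin 4) = 2 := rfl
  have e1 : (1 + 2 : Fin 4) = 3 := rfl
  have e2 : (2 + 2 : Fin 4) = 0 := rfl
  have e3 : (3 + 2 : Fin 4) = 1 := rfl
  rw [e0] at h0
  rw [e1] at h1
  rw [e2] at h2
  rw [e3] at h3
  simp only [flip]
  cases u 0 <;> cases u 1 <;> cases u 2 <;> cases u 3 <;> simp [fv, h0, h1, h2, h3] <;>
    field_simp <;> rw [hD] <;> ring

end Fort

namespace Fort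
open Finset

def R1 (a b : ℕ) : Prop := a + b = 1
lemma R1_symm : ∀ a b, R1 a b → R1 b a := fun a b h => by unfold R1 at *; omega
lemma R1_le : ∀ a b, R1 a b → a ≤ 1 := fun a b h => by unfold R1 at *; omega

lemma f_scale (c : ℚ) (w : Fin 4 → ℚ) (u : Fin 4 → Bool) :
    f (fun d => c * w d) u = c ^ ((u 0).toNat + (u 2).toNat) * f w u := by
  rw [f_eq, f_eq]
  cases u 0 <;> cases u 1 <;> cases u 2 <;> cases u 3 <;> simp [fv]
  ring

lemma count_u (n : ℕ) (v : Bk n → Fin 4 → ℕ) (h : Cond n R1 v (fun _ _ => 0)) :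
    ∑ b : Bk n, (v b 0 + v b 2) = n * (n + 1) := by
  rw [cond_iff _ _ R1_symm] at h
  rw [Fintype.sum_prod_type]
  have key : ∀ i : Fin n, ∑ j : Fin n, (v (i, j) 0 + v (i, j) 2) = n + 1 := by
    intro i
    have hi := i.2
    set e := ext v (fun _ _ => 0) with he
    have h1 : ∑ j ∈ range (n + 1), (e (i : ℕ) ((j : ℤ) - 1) 0 + e (i : ℕ) (j : ℤ) 2) = n + 1 := by
      rw [Finset.sum_congr rfl (g := fun _ => 1)]
      · simp
      · intro j hj
        rw [mem_range] at hj
        exact (h (i : ℕ) (j : ℕ) (by omega) (by omega) (by omega) (by omega)).1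
    rw [Finset.sum_add_distrib, Finset.sum_range_succ', Finset.sum_range_succ _ n] at h1
    have h2 : e (i : ℕ) (((0 : ℕ) : ℤ) - 1) 0 = 0 := ext_out _ _ _ (by omega)
    have h3 : e (i : ℕ) (n : ℤ) 2 = 0 := ext_out _ _ _ (by omega)
    rw [h2, h3] at h1
    rw [Finset.sum_add_distrib]
    have h4 : ∀ d, ∑ j : Fin n, v (i, j) d = ∑ j ∈ range n, e (i : ℕ) (j : ℤ) d := by
      intro d
      rw [Finset.sum_range]
      exact Finset.sum_congr rfl fun j _ => (ext_in v _ (i, j) d).symm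
    rw [h4, h4]
    simpa using h1
  simp [key]

lemma P_scale (n : ℕ) (c : ℚ) (w : Bk n → Fin 4 → ℚ) :
    P n R1 (fun _ _ => false) (fun b d => c * w b d) =
      c ^ (n * (n + 1)) * P n R1 (fun _ _ => false) w := by
  classical
  unfold P
  rw [Finset.mul_sum]
  refine Finset.sum_congr rfl fun u _ => ?_
  split_ifs with h
  · simp_rw [f_scale]
    rw [Finset.prod_mul_distrib, Finset.prod_pow_eq_pow_sum]
    have := count_u n (tn u) h
    unfold tn at this
    rw [this]
  · simp

/-! ### reindexing -/
def px : Fin 4 → ℕ := ![1, 1, 0, 0]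
def qx : Fin 4 → ℕ := ![1, 0, 0, 1]
lemma px_le (d : Fin 4) : px d ≤ 1 := by fin_cases d <;> decide
lemma qx_le (d : Fin 4) : qx d ≤ 1 := by fin_cases d <;> decide

def iob {n : ℕ} (b : Bk n) (d : Fin 4) : Bk (n + 1) :=
  (⟨(b.1 : ℕ) + px d, by have := px_le d; omega⟩, ⟨(b.2 : ℕ) + qx d, by have := qx_le d; omega⟩)

def emb {n : ℕ} (X : Bk n → Fin 4 → Bool) : Bk (n + 1) → Fin 4 → Bool := fun b d =>
  ext X (fun _ _ => false) ((b.1 : ℕ) - (px (d + 2) : ℕ)) ((b.2 : ℕ) - (qx (d + 2) : ℕ)) (d + 2)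

lemma d22 (d : Fin 4) : d + 2 + 2 = d := by fin_cases d <;> rfl

lemma emb_iob {n : ℕ} (X : Bk n → Fin 4 → Bool) (b : Bk n) (d : Fin 4) :
    emb X (iob b d) (d + 2) = X b d := by
  unfold emb
  rw [d22]
  exact ext_in' _ _ b d (by simp [iob]) (by simp [iob])

def ev {n : ℕ} (X : Bk n → Fin 4 → Bool) (i j : ℤ) (d : Fin 4) : ℕ :=
  (ext X (fun _ _ => false) i j d).toNat

lemma ev_emb {n : ℕ} (X : Bk n → Fin 4 → Bool) (i j : ℤ) (d : Fin 4) :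
    ev (emb X) i j d = ev X (i - (px (d + 2) : ℕ)) (j - (qx (d + 2) : ℕ)) (d + 2) := by
  unfold ev
  congr 1
  by_cases h : (0 ≤ i ∧ i < (n + 1 : ℕ)) ∧ (0 ≤ j ∧ j < (n + 1 : ℕ))
  · obtain ⟨b, h1, h2⟩ := exists_bk h
    rw [ext_in' _ _ b d h1 h2]
    unfold emb
    rw [h1, h2]
  · rw [ext_out _ _ _ h, ext_out]
    have := px_le (d + 2)
    have := qx_le (d + 2)
    omega

lemma ext_st {n : ℕ} (X : Bk n → Fin 4 → Bool) (i j : ℤ) (d : Fin 4) :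
    ext (fun b => st (X b)) (fun _ _ => 0) i j d = ev X i j d + ev X i j (d + 3) := by
  unfold ev
  by_cases h : (0 ≤ i ∧ i < n) ∧ (0 ≤ j ∧ j < n)
  · obtain ⟨b, h1, h2⟩ := exists_bk h
    simp only [ext_in' _ _ b _ h1 h2]
    rfl
  · simp only [ext_out _ _ _ h]
    rfl

lemma ext_st_in {n : ℕ} (X : Bk n → Fin 4 → Bool) (o : ℤ → ℤ → ℕ) (i j : ℤ) (d : Fin 4)
    (h : (0 ≤ i ∧ i < n) ∧ (0 ≤ j ∧ j < n)) :
    ext (fun b => st (X b)) o i j d = ev X i j d + ev X i j (d + 3) := by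
  unfold ev
  obtain ⟨b, h1, h2⟩ := exists_bk h
  simp only [ext_in' _ _ b _ h1 h2]
  rfl

lemma ev_out {n : ℕ} (X : Bk n → Fin 4 → Bool) (i j : ℤ) (d : Fin 4)
    (h : ¬ ((0 ≤ i ∧ i < n) ∧ (0 ≤ j ∧ j < n))) : ev X i j d = 0 := by
  unfold ev; rw [ext_out _ _ _ h]; rfl

lemma cond_emb {n : ℕ} (X : Bk n → Fin 4 → Bool) :
    Cond n R1 (fun b => st (X b)) (fun _ _ => 0) ↔
      Cond (n + 1) R1 (fun b => st (emb X b)) (fun _ _ => 1) := by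
  rw [cond_iff _ _ R1_symm, cond_iff _ _ R1_symm]
  have a20 : (2 + 3 : Fin 4) = 1 := rfl
  have a30 : (3 + 3 : Fin 4) = 2 := rfl
  have a13 : (1 + 3 : Fin 4) = 0 := rfl
  have a03 : (0 + 3 : Fin 4) = 3 := rfl
  have E0 := fun i j => ev_emb X i j 0
  have E1 := fun i j => ev_emb X i j 1
  have E2 := fun i j => ev_emb X i j 2
  have E3 := fun i j => ev_emb X i j 3
  have e0 : (0 + 2 : Fin 4) = 2 := rfl
  have e1 : (1 + 2 : Fin 4) = 3 := rfl
  have e2 : (2 + 2 : Fin 4) = 0 := rfl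
  have e3 : (3 + 2 : Fin 4) = 1 := rfl
  have p0 : px 0 = 1 := rfl
  have p1 : px 1 = 1 := rfl
  have p2 : px 2 = 0 := rfl
  have p3 : px 3 = 0 := rfl
  have q0 : qx 0 = 1 := rfl
  have q1 : qx 1 = 0 := rfl
  have q2 : qx 2 = 0 := rfl
  have q3 : qx 3 = 1 := rfl
  simp only [e0, e1, e2, e3, p0, p1, p2, p3, q0, q1, q2, q3, Nat.cast_zero, Nat.cast_one, sub_zero]
    at E0 E1 E2 E3
  constructor
  · intro h i j hi hi' hj hj'
    push_cast at hi' hj'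
    rcases lt_trichotomy j 0 with hj0 | rfl | hj0
    · omega
    · rw [ext_out _ _ 0 (by omega), ext_out _ _ 1 (by omega),
        ext_st_in _ _ _ _ _ (by omega), ext_st_in _ _ _ _ _ (by omega)]
      simp only [a20, a30, E0, E1, E2, E3]
      rw [ev_out X _ _ 0 (by omega), ev_out X _ _ 3 (by omega), ev_out X _ _ 1 (by omega),
        ev_out X _ _ 0 (by omega)]
      exact ⟨rfl, rfl⟩
    by_cases hjn : j = n + 1
    · rw [ext_out _ _ 2 (by push_cast; omega), ext_out _ _ 3 (by push_cast; omega),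
        ext_st_in _ _ _ _ _ (by push_cast; omega), ext_st_in _ _ _ _ _ (by push_cast; omega)]
      simp only [a03, a13, E0, E1, E2, E3]
      rw [ev_out X _ _ 2 (by omega), ev_out X _ _ 1 (by omega), ev_out X _ _ 3 (by omega),
        ev_out X _ _ 2 (by omega)]
      exact ⟨rfl, rfl⟩
    · have := h (j-1) i (by omega) (by omega) (by omega) (by omega)
      simp only [ext_st, a20, a30, a03, a13] at this
      rw [ext_st_in _ _ _ _ _ (by push_cast; omega), ext_st_in _ _ _ _ _ (by push_cast; omega),
        ext_st_in _ _ _ _ _ (by push_cast; omega), ext_st_in _ _ _ _ _ (by push_cast; omega)]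
      simp only [a20, a30, a03, a13, E0, E1, E2, E3]
      unfold R1 at *
      constructor
      · have := this.2; omega
      · have := this.1; omega
  · intro h i j hi hi' hj hj'
    have := h j (i+1) (by omega) (by push_cast; omega) (by omega) (by push_cast; omega)
    rw [ext_st_in _ _ _ _ _ (by push_cast; omega), ext_st_in _ _ _ _ _ (by push_cast; omega),
        ext_st_in _ _ _ _ _ (by push_cast; omega), ext_st_in _ _ _ _ _ (by push_cast; omega)] at this
    simp only [a20, a30, a03, a13, E0, E1, E2, E3, add_sub_cancel_right] at this
    simp only [ext_st, a20, a30, a03, a13]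
    unfold R1 at *
    constructor
    · have := this.2; omega
    · have := this.1; omega

lemma emb_res {n : ℕ} (X : Bk (n + 1) → Fin 4 → Bool)
    (h : Cond (n + 1) R1 (fun b => st (X b)) (fun _ _ => 1)) :
    emb (fun b d => X (iob b d) (d + 2)) = X := by
  funext b d
  unfold emb
  by_cases hr : (0 ≤ ((b.1 : ℕ) : ℤ) - (px (d + 2) : ℕ) ∧ ((b.1 : ℕ) : ℤ) - (px (d + 2) : ℕ) < n) ∧
      (0 ≤ ((b.2 : ℕ) : ℤ) - (qx (d + 2) : ℕ) ∧ ((b.2 : ℕ) : ℤ) - (qx (d + 2) : ℕ) < n)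
  · obtain ⟨c, h1, h2⟩ := exists_bk hr
    rw [ext_in' _ _ c _ h1 h2]
    have : iob c (d + 2) = b := by
      unfold iob
      ext <;> simp <;> omega
    rw [this, d22]
  · rw [ext_out _ _ _ hr]
    have hb1 := b.1.2
    have hb2 := b.2.2
    -- some direction is on the boundary
    have key : ∀ d', ¬ ((0 ≤ ((b.1 : ℕ) : ℤ) + dx d' ∧ ((b.1 : ℕ) : ℤ) + dx d' < (n + 1 : ℕ)) ∧
      (0 ≤ ((b.2 : ℕ) : ℤ) + dy d' ∧ ((b.2 : ℕ) : ℤ) + dy d' < (n + 1 : ℕ))) →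
      X b d' = false ∧ X b (d' + 3) = false := by
      intro d' hd'
      have := h b d'
      rw [ext_out _ _ _ hd'] at this
      unfold R1 st at this
      constructor
      · cases hx : X b d' <;> simp_all
      · cases hx : X b (d' + 3) <;> simp_all
    symm
    fin_cases d
    · simp [px, qx] at hr
      by_cases hc : (b.2 : ℕ) < n
      · exact (key 1 (by simp [dx, dy]; omega)).2
      · exact (key 0 (by simp [dx, dy]; omega)).1
    · simp [px, qx] at hr
      by_cases hc : (b.1 : ℕ) < n
      · exact (key 2 (by simp [dx, dy]; omega)).2
      · exact (key 1 (by simp [dx, dy]; omega)).1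
    · simp [px, qx] at hr
      by_cases hc : 0 < (b.1 : ℕ)
      · exact (key 2 (by simp [dx, dy]; omega)).1
      · exact (key 3 (by simp [dx, dy]; omega)).2
    · simp [px, qx] at hr
      by_cases hc : 0 < (b.1 : ℕ)
      · exact (key 0 (by simp [dx, dy]; omega)).2
      · exact (key 3 (by simp [dx, dy]; omega)).1

lemma prod_emb {n : ℕ} (X : Bk n → Fin 4 → Bool) (w : Bk (n + 1) → Fin 4 → ℚ) :
    ∏ b, wt (w b) (emb X b) = ∏ b, wt (fun d => w (iob b d) (d + 2)) (X b) := by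
  unfold wt
  rw [← Fintype.prod_prod_type' (f := fun b d => if emb X b d then w b d else 1),
    ← Fintype.prod_prod_type' (f := fun b d => if X b d then w (iob b d) (d + 2) else 1)]
  symm
  refine Fintype.prod_of_injective (fun e : Bk n × Fin 4 => (iob e.1 e.2, e.2 + 2)) ?_ _ _ ?_ ?_
  · rintro ⟨⟨i, j⟩, d⟩ ⟨⟨i', j'⟩, d'⟩ h
    simp only [Prod.mk.injEq] at h
    have hd : d = d' := by have := h.2; simpa using this
    subst hd
    have := h.1
    simp [iob] at this
    ext <;> simp <;> omega
  · rintro ⟨b, d⟩ hb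
    simp only
    rw [if_neg]
    intro he
    unfold emb at he
    by_cases hr : (0 ≤ ((b.1 : ℕ) : ℤ) - (px (d + 2) : ℕ) ∧
        ((b.1 : ℕ) : ℤ) - (px (d + 2) : ℕ) < n) ∧
      (0 ≤ ((b.2 : ℕ) : ℤ) - (qx (d + 2) : ℕ) ∧ ((b.2 : ℕ) : ℤ) - (qx (d + 2) : ℕ) < n)
    · obtain ⟨c, h1, h2⟩ := exists_bk hr
      apply hb
      refine ⟨(c, d + 2), ?_⟩
      simp only [d22]
      congr 1
      unfold iob
      ext <;> simp <;> omega
    · rw [ext_out _ _ _ hr] at he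
      simp at he
  · rintro ⟨b, d⟩
    simp only [emb_iob]

lemma P_shrink (n : ℕ) (w : Bk (n + 1) → Fin 4 → ℚ) :
    P (n + 1) R1 (fun _ _ => true) w =
      P n R1 (fun _ _ => false) (fun b d => w (iob b d) (d + 2)) := by
  classical
  rw [P_eq_X _ _ R1_le, P_eq_X _ _ R1_le, ← Finset.sum_filter, ← Finset.sum_filter]
  symm
  refine Finset.sum_bij' (fun X _ => emb X) (fun X _ => fun b d => X (iob b d) (d + 2)) ?_ ?_ ?_ ?_ ?_
  · intro X hX
    simp only [mem_filter, mem_univ, true_and] at hX ⊢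
    exact (cond_emb X).1 hX
  · intro X hX
    simp only [mem_filter, mem_univ, true_and] at hX ⊢
    refine (cond_emb _).2 ?_
    rw [emb_res X hX]
    exact hX
  · intro X _
    funext b d
    exact emb_iob X b d
  · intro X hX
    simp only [mem_filter, mem_univ, true_and] at hX
    exact emb_res X hX
  · intro X _
    exact (prod_emb X w).symm

end Fort

namespace Fort
open Finset

def kap (ε : Bool) (i j : ℤ) : Bool := xor ε (decide ((i + j) % 2 = 0))
def Req (a b : ℕ) : Prop := a = b ∧ a ≤ 1
def kb {n : ℕ} (ε : Bool) (b : Bk n) : Bool := kap ε (b.1 : ℕ) (b.2 : ℕ)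

lemma kap_nb (ε : Bool) (i j : ℤ) (d : Fin 4) : kap ε (i + dx d) (j + dy d) = !kap ε i j := by
  have : (dx d = 0 ∧ dy d = 1) ∨ (dx d = 1 ∧ dy d = 0) ∨ (dx d = 0 ∧ dy d = -1) ∨
      (dx d = -1 ∧ dy d = 0) := by fin_cases d <;> simp [dx, dy]
  unfold kap
  by_cases h : (i + j) % 2 = 0
  · have h2 : ¬ ((i + dx d + (j + dy d)) % 2 = 0) := by omega
    simp [h, h2]
  · have h2 : ((i + dx d + (j + dy d)) % 2 = 0) := by omega
    simp [h, h2]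

noncomputable def G (n : ℕ) (ε : Bool) : ℚ := P n Req (kap ε) (fun _ _ => 1)

lemma f_half (u : Fin 4 → Bool) : f (fun _ => 1) u = 2 * f (fun _ => 1 / 2) (flip true u) :=
  f_compl _ _ 2 (by norm_num) (by norm_num) (fun _ => rfl) u

lemma flip_false (u : Fin 4 → Bool) : flip false u = u := by funext d; simp [flip]

lemma G_flip1 (n : ℕ) (ε : Bool) : G n ε = (∏ b : Bk n, if kb ε b then 1 else 2) *
    P n R1 (fun _ _ => true) (fun b _ => if kb ε b then 1 else 1 / 2) := by
  unfold G
  rw [P_flip n Req R1 (kap ε) (fun i j => !kap ε i j) _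
    (fun b _ => if kb ε b then 1 else 1 / 2) (fun b => if kb ε b then 1 else 2)]
  · congr 2
    funext i j
    simp
  · intro i j d p q
    rw [kap_nb]
    unfold Req R1
    cases kap ε i j <;> cases p <;> cases q <;> simp
  · intro b u
    change _ = _ * f _ (flip (!kb ε b) u)
    cases kb ε b
    · simpa using f_half u
    · simp [flip_false]

lemma G_flip0 (n : ℕ) (ε : Bool) : G n ε = (∏ b : Bk n, if kb ε b then 2 else 1) *
    P n R1 (fun _ _ => false) (fun b _ => if kb ε b then 1 / 2 else 1) := by
  unfold G
  rw [P_flip n Req R1 (kap ε) (fun i j => kap ε i j) _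
    (fun b _ => if kb ε b then 1 / 2 else 1) (fun b => if kb ε b then 2 else 1)]
  · congr 2
    funext i j
    simp
  · intro i j d p q
    rw [kap_nb]
    unfold Req R1
    cases kap ε i j <;> cases p <;> cases q <;> simp
  · intro b u
    change _ = _ * f _ (flip (kb ε b) u)
    cases kb ε b
    · simp [flip_false]
    · simpa using f_half u

lemma P_compl (n : ℕ) (D : ℚ) (hD0 : D ≠ 0) (w w' : Bk n → Fin 4 → ℚ)
    (hD : ∀ b, D = w b 0 * w b 2 + w b 1 * w b 3) (hw : ∀ b d, w' b d = w b (d + 2) / D) :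
    P n R1 (fun _ _ => false) w = D ^ (n * n) * P n R1 (fun _ _ => true) w' := by
  rw [P_flip n R1 R1 _ (fun _ _ => true) w w' (fun _ => D)]
  · simp
  · intro i j d p q
    unfold R1
    cases p <;> cases q <;> simp
  · intro b u
    exact f_compl _ _ _ (hD b) hD0 (hw b) u

def od (d : Fin 4) : Bool := decide (d = 1 ∨ d = 3)

lemma kb_iob {n : ℕ} (ε : Bool) (b : Bk n) (d : Fin 4) : kb ε (iob b d) = xor (kb ε b) (od d) := by
  unfold kb kap iob
  simp only [Nat.cast_add]
  have : (px d + qx d) % 2 = if od d then 1 else 0 := by fin_cases d <;> decide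
  by_cases h : (((b.1 : ℕ) : ℤ) + ((b.2 : ℕ) : ℤ)) % 2 = 0
  · cases hd : od d
    · rw [hd] at this
      have h2 : (((b.1 : ℕ) : ℤ) + (px d : ℕ) + (((b.2 : ℕ) : ℤ) + (qx d : ℕ))) % 2 = 0 := by
        simp at this; omega
      simp [h, h2]
    · rw [hd] at this
      have h2 : ¬ (((b.1 : ℕ) : ℤ) + (px d : ℕ) + (((b.2 : ℕ) : ℤ) + (qx d : ℕ))) % 2 = 0 := by
        simp at this; omega
      simp [h, h2]
  · cases hd : od d
    · rw [hd] at this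
      have h2 : ¬ (((b.1 : ℕ) : ℤ) + (px d : ℕ) + (((b.2 : ℕ) : ℤ) + (qx d : ℕ))) % 2 = 0 := by
        simp at this; omega
      simp [h, h2]
    · rw [hd] at this
      have h2 : (((b.1 : ℕ) : ℤ) + (px d : ℕ) + (((b.2 : ℕ) : ℤ) + (qx d : ℕ))) % 2 = 0 := by
        simp at this; omega
      simp [h, h2]

lemma od2 (d : Fin 4) : od (d + 2) = od d := by fin_cases d <;> rfl

lemma kb_not {n : ℕ} (ε : Bool) (b : Bk n) : kb (!ε) b = !kb ε b := by
  unfold kb kap; cases ε <;> simp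

def cc (ε : Bool) (k : ℕ) : ℚ := if kap ε k 0 then 1 else 2
lemma cc_succ (ε : Bool) (k : ℕ) : cc ε k * cc ε (k + 1) = 2 := by
  have h := kap_nb ε k 0 1
  unfold cc
  simp [dx, dy] at h
  push_cast
  rw [h]
  cases kap ε k 0 <;> simp

lemma c_prod (ε : Bool) (n : ℕ) : (∏ b : Bk n, if kb ε b then (1 : ℚ) else 2) =
    ∏ i ∈ range n, ∏ j ∈ range n, cc ε (i + j) := by
  rw [Fintype.prod_prod_type, Finset.prod_range]
  refine Finset.prod_congr rfl fun i _ => ?_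
  rw [Finset.prod_range]
  refine Finset.prod_congr rfl fun j _ => ?_
  unfold cc kb kap
  simp

lemma c_rec (ε : Bool) (k : ℕ) : (∏ b : Bk (k + 2), if kb ε b then (1 : ℚ) else 2) =
    4 ^ (k + 1) * ∏ b : Bk k, if kb ε b then (1 : ℚ) else 2 := by
  rw [c_prod, c_prod]
  have h1 : ∀ i, ∏ j ∈ range (k + 2), cc ε (i + j) = 2 * ∏ j ∈ range k, cc ε (i + j) := by
    intro i
    rw [Finset.prod_range_succ, Finset.prod_range_succ, mul_assoc, ← add_assoc, cc_succ, mul_comm]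
  simp_rw [h1]
  rw [Finset.prod_mul_distrib, Finset.prod_const, card_range,
    Finset.prod_range_succ _ (k + 1), Finset.prod_range_succ _ k,
    mul_assoc (∏ i ∈ range k, ∏ j ∈ range k, cc ε (i + j)), ← Finset.prod_mul_distrib]
  have h2 : ∏ i ∈ range k, (cc ε (k + i) * cc ε (k + 1 + i)) = 2 ^ k := by
    rw [Finset.prod_congr rfl (g := fun _ => 2)]
    · simp
    · intro i _
      rw [show k + 1 + i = k + i + 1 by ring, cc_succ]
  rw [h2]
  rw [show (4 : ℚ) = 2 ^ 2 by norm_num, ← pow_mul]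
  ring

lemma G_rec (k : ℕ) (ε : Bool) : G (k + 2) ε = 5 ^ (k + 1) * G k (!ε) := by
  have e2 : G k (!ε) = (∏ b : Bk k, if kb ε b then 1 else 2) *
      P k R1 (fun _ _ => false) (fun b _ => if kb ε b then 1 else 1 / 2) := by
    rw [G_flip0]
    simp only [kb_not]
    congr 1
    · refine Finset.prod_congr rfl fun b _ => ?_
      cases kb ε b <;> simp
    · congr 1
      funext b d
      cases kb ε b <;> simp
  rw [e2, G_flip1, c_rec, P_shrink]
  rw [P_compl (k + 1) (5 / 4) (by norm_num) _
    (fun b d => (4 / 5) * (if xor (kb ε b) (od d) then 1 else 1 / 2))]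
  · rw [P_shrink]
    have : (fun (b : Bk k) (d : Fin 4) =>
        (4 / 5 : ℚ) * (if xor (kb ε (iob b d)) (od (d + 2)) then 1 else 1 / 2)) =
        fun b d => (4 / 5 : ℚ) * (fun b _ => if kb ε b then 1 else 1 / 2) b d := by
      funext b d
      rw [kb_iob, od2]
      simp
    rw [this, P_scale]
    have h3 : (5 / 4 : ℚ) ^ ((k + 1) * (k + 1)) * (4 / 5) ^ (k * (k + 1)) = (5 / 4) ^ (k + 1) := by
      rw [show (k + 1) * (k + 1) = k * (k + 1) + (k + 1) by ring, pow_add, mul_right_comm,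
        ← mul_pow]
      norm_num
    have h4 : (4 : ℚ) ^ (k + 1) * (5 / 4) ^ (k + 1) = 5 ^ (k + 1) := by
      rw [← mul_pow]; norm_num
    rw [← h4, ← h3]
    ring
  · intro b
    simp only [kb_iob]
    cases kb ε b <;> simp [od] <;> norm_num
  · intro b d
    rw [kb_iob, od2]
    cases kb ε b <;> cases od d <;> norm_num

lemma G_zero (ε : Bool) : G 0 ε = 1 := by
  classical
  unfold G P
  rw [Fintype.sum_unique, if_pos]
  · simp
  · intro b; exact b.1.elim0

lemma G_one (ε : Bool) : G 1 ε = if ε then 2 else 1 := by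
  rw [G_flip1, P_shrink]
  have : ∀ w, P 0 R1 (fun _ _ => false) w = 1 := by
    intro w
    classical
    unfold P
    rw [Fintype.sum_unique, if_pos]
    · simp
    · intro b; exact b.1.elim0
  rw [this]
  rw [Fintype.prod_prod_type]
  cases ε <;> simp [kb, kap]

lemma G_val (n : ℕ) : ∀ ε, ∃ k : ℕ, G n ε = 5 ^ k ∨ G n ε = 2 * 5 ^ k := by
  induction n using Nat.twoStepInduction with
  | zero => intro ε; exact ⟨0, by simp [G_zero]⟩
  | one => intro ε; exact ⟨0, by rw [G_one]; cases ε <;> simp⟩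
  | more n ih _ =>
    intro ε
    obtain ⟨k, hk⟩ := ih (!ε)
    refine ⟨n + 1 + k, ?_⟩
    rw [G_rec]
    rcases hk with hk | hk
    · left; rw [hk, pow_add _ _ k]
    · right; rw [hk, pow_add _ _ k]; ring

lemma G_count (n : ℕ) (ε : Bool) : G n ε =
    (({X : Bk n → Fin 4 → Bool |
      Cond n Req (fun b => st (X b)) (fun i j => (kap ε i j).toNat)} : Set _).ncard : ℚ) := by
  classical
  unfold G
  rw [P_eq_X _ _ (fun a b h => h.2)]
  simp [wt, Set.ncard_eq_toFinset_card']

end Fort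

namespace Fort
open Finset

def Nbr {n : ℕ} (b : Bk n) (d : Fin 4) (b' : Bk n) : Prop :=
  ((b'.1 : ℕ) : ℤ) = (b.1 : ℕ) + dx d ∧ ((b'.2 : ℕ) : ℤ) = (b.2 : ℕ) + dy d

lemma removed_iff {n : ℕ} (ε : Bool) (b : Bk n) (d : Fin 4) : removed ε ((b, d) : Tri n) ↔
    kb ε b = true ∧ ¬ ∃ b', Nbr b d b' := by
  have hn : (∃ b', Nbr b d b') ↔ (0 ≤ ((b.1 : ℕ) : ℤ) + dx d ∧ ((b.1 : ℕ) : ℤ) + dx d < n) ∧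
      (0 ≤ ((b.2 : ℕ) : ℤ) + dy d ∧ ((b.2 : ℕ) : ℤ) + dy d < n) := by
    constructor
    · rintro ⟨b', h1, h2⟩
      have := b'.1.2
      have := b'.2.2
      omega
    · exact fun h => exists_bk h
  rw [hn]
  have h1 := b.1.2
  have h2 := b.2.2
  unfold removed triColor kb kap
  have hc : decide ((((b.1 : ℕ) : ℤ) + ((b.2 : ℕ) : ℤ)) % 2 = 0) =
    decide (((b.1 : ℕ) + (b.2 : ℕ)) % 2 = 0) := by
    congr 1
    apply propext
    omega
  simp only [hc]
  generalize decide (((b.1 : ℕ) + (b.2 : ℕ)) % 2 = 0) = p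
  fin_cases d <;> cases ε <;> cases p <;> simp [dx, dy] <;> omega

lemma adj_iff {n : ℕ} (ε : Bool) (b b' : Bk n) (d d' : Fin 4) :
    (fortressGraph n ε).Adj (b, d) (b', d') ↔ ¬ removed ε ((b, d) : Tri n) ∧
      ¬ removed ε ((b', d') : Tri n) ∧
      ((b = b' ∧ (d' = d + 1 ∨ d = d' + 1)) ∨ (Nbr b d b' ∧ d' = d + 2)) := by
  unfold fortressGraph
  rw [SimpleGraph.fromRel_adj]
  generalize removed ε ((b, d) : Tri n) = p
  generalize removed ε ((b', d') : Tri n) = q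
  have key : ((b, d) ≠ (b', d') ∧ (triRel ((b, d) : Tri n) (b', d') ∨
      triRel ((b', d') : Tri n) (b, d))) ↔
      ((b = b' ∧ (d' = d + 1 ∨ d = d' + 1)) ∨ (Nbr b d b' ∧ d' = d + 2)) := by
    obtain ⟨i, j⟩ := b
    obtain ⟨i', j'⟩ := b'
    unfold triRel Nbr
    simp only [Prod.mk.injEq, ne_eq, Fin.ext_iff]
    fin_cases d <;> fin_cases d' <;> simp [dx, dy] <;> omega
  tauto

lemma d_ne1 (d : Fin 4) : d + 1 ≠ d := by fin_cases d <;> decide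
lemma d_ne2 (d : Fin 4) : d + 2 ≠ d := by fin_cases d <;> decide
lemma d31 (d : Fin 4) : d + 3 + 1 = d := by fin_cases d <;> decide
lemma d13 (d : Fin 4) : d + 1 + 3 = d := by fin_cases d <;> decide
lemma d11 (d : Fin 4) : d + 1 + 1 ≠ d := by fin_cases d <;> decide
lemma d3_ne (d : Fin 4) : d + 3 ≠ d := by fin_cases d <;> decide

lemma Nbr.symm {n : ℕ} {b b' : Bk n} {d : Fin 4} (h : Nbr b d b') : Nbr b' (d + 2) b := by
  unfold Nbr at *
  have : dx (d + 2) = - dx d ∧ dy (d + 2) = - dy d := by fin_cases d <;> simp [dx, dy]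
  omega

lemma Nbr.ne {n : ℕ} {b b' : Bk n} {d : Fin 4} (h : Nbr b d b') : b ≠ b' := by
  rintro rfl
  unfold Nbr at h
  have : (dx d = 0 ∧ dy d = 1) ∨ (dx d = 1 ∧ dy d = 0) ∨ (dx d = 0 ∧ dy d = -1) ∨
      (dx d = -1 ∧ dy d = 0) := by fin_cases d <;> simp [dx, dy]
  omega

lemma Nbr.uniq {n : ℕ} {b b' b'' : Bk n} {d : Fin 4} (h : Nbr b d b') (h' : Nbr b d b'') :
    b' = b'' := by
  unfold Nbr at *
  ext <;> omega

def leg {n : ℕ} (b : Bk n) (d : Fin 4) : Sym2 (Tri n) := s((b, d), (b, d + 1))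
def hyp {n : ℕ} (b : Bk n) (d : Fin 4) (b' : Bk n) : Sym2 (Tri n) := s((b, d), (b', d + 2))

lemma hyp_symm {n : ℕ} (b : Bk n) (d : Fin 4) (b' : Bk n) : hyp b d b' = hyp b' (d + 2) b := by
  unfold hyp; rw [d22, Sym2.eq_swap]

lemma pair_eq {n : ℕ} {b c : Bk n} {d e : Fin 4} :
    ((b, d) : Tri n) = (c, e) ↔ b = c ∧ d = e := Prod.mk_inj

lemma mem_leg {n : ℕ} {b c : Bk n} {d e : Fin 4} :
    ((b, d) : Tri n) ∈ leg c e ↔ b = c ∧ (e = d ∨ e = d + 3) := by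
  unfold leg
  rw [Sym2.mem_iff, pair_eq, pair_eq, ← and_or_left]
  refine and_congr_right fun _ => ?_
  constructor
  · rintro (rfl | rfl)
    · left; rfl
    · right; rw [d13]
  · rintro (rfl | rfl)
    · left; rfl
    · right; rw [d31]

lemma leg_inj {n : ℕ} {b c : Bk n} {d e : Fin 4} (h : leg b d = leg c e) : b = c ∧ d = e := by
  have h1 : ((b, d) : Tri n) ∈ leg c e := by rw [← h]; exact mem_leg.2 ⟨rfl, Or.inl rfl⟩
  have h2 : ((b, d + 1) : Tri n) ∈ leg c e := by
    rw [← h]; exact mem_leg.2 ⟨rfl, Or.inr (d13 d).symm⟩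
  rw [mem_leg] at h1 h2
  refine ⟨h1.1, ?_⟩
  rcases h1.2 with h3 | h3
  · exact h3.symm
  · rcases h2.2 with h4 | h4
    · exfalso; rw [h3] at h4; revert h4; clear * -; revert d; decide
    · rw [h4, d13]

lemma leg_ne_hyp {n : ℕ} {b c c' : Bk n} {d e : Fin 4} (hc : Nbr c e c') : leg b d ≠ hyp c e c' := by
  intro h
  have h1 : ((c, e) : Tri n) ∈ leg b d := by rw [h]; exact Sym2.mem_mk_left _ _
  have h2 : ((c', e + 2) : Tri n) ∈ leg b d := by rw [h]; exact Sym2.mem_mk_right _ _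
  rw [mem_leg] at h1 h2
  exact hc.ne (h1.1.trans h2.1.symm)

/-- every edge at a vertex is one of the two legs or the hypotenuse -/
lemma edge_cases {n : ℕ} {ε : Bool} {e : Sym2 (Tri n)} (he : e ∈ (fortressGraph n ε).edgeSet)
    {b : Bk n} {d : Fin 4} (h : ((b, d) : Tri n) ∈ e) :
    ¬ removed ε ((b, d) : Tri n) ∧
      (e = leg b d ∨ e = leg b (d + 3) ∨ ∃ b', Nbr b d b' ∧ e = hyp b d b') := by
  obtain ⟨⟨b', d'⟩, rfl⟩ := Sym2.mem_iff_exists.1 h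
  rw [SimpleGraph.mem_edgeSet, adj_iff] at he
  refine ⟨he.1, ?_⟩
  rcases he.2.2 with ⟨rfl, rfl | rfl⟩ | ⟨h1, rfl⟩
  · left; rfl
  · right; left; unfold leg; rw [d13, Sym2.eq_swap]
  · right; right; exact ⟨b', h1, rfl⟩

lemma edge_cases' {n : ℕ} {ε : Bool} {e : Sym2 (Tri n)} (he : e ∈ (fortressGraph n ε).edgeSet) :
    (∃ b d, e = leg b d) ∨ ∃ b d b', Nbr b d b' ∧ e = hyp b d b' := by
  induction e with
  | _ t t' =>
    obtain ⟨b, d⟩ := t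
    rcases (edge_cases he (b := b) (d := d) (Sym2.mem_mk_left _ _)).2 with h | h | ⟨b', h1, h⟩
    · exact Or.inl ⟨_, _, h⟩
    · exact Or.inl ⟨_, _, h⟩
    · exact Or.inr ⟨_, _, _, h1, h⟩

open Classical in
noncomputable def Phi {n : ℕ} (M : Finset (Sym2 (Tri n))) : Bk n → Fin 4 → Bool :=
  fun b d => decide (leg b d ∈ M)

lemma st_eq_zero {x : Fin 4 → Bool} {d : Fin 4} :
    st x d = 0 ↔ x d = false ∧ x (d + 3) = false := by
  unfold st
  cases x d <;> cases x (d + 3) <;> simp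

lemma st_eq_one {x : Fin 4 → Bool} {d : Fin 4} :
    st x d = 1 ↔ (x d = true ∧ x (d + 3) = false) ∨ (x d = false ∧ x (d + 3) = true) := by
  unfold st
  cases x d <;> cases x (d + 3) <;> simp

section
variable {n : ℕ} {ε : Bool} {M : Finset (Sym2 (Tri n))}

lemma pm_removed (hM : IsPM (fortressGraph n ε) {t | ¬ removed ε t} M) {b : Bk n} {d : Fin 4}
    (hr : removed ε ((b, d) : Tri n)) : st (Phi M b) d = 0 := by
  rw [st_eq_zero]
  unfold Phi
  simp only [decide_eq_false_iff_not]
  constructor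
  · intro h
    exact (edge_cases (hM.1 _ h) (mem_leg.2 ⟨rfl, Or.inl rfl⟩)).1 hr
  · intro h
    exact (edge_cases (hM.1 _ h) (mem_leg.2 ⟨rfl, Or.inr rfl⟩)).1 hr

/-- degree dichotomy at a non removed vertex -/
lemma pm_deg (hM : IsPM (fortressGraph n ε) {t | ¬ removed ε t} M) {b : Bk n} {d : Fin 4}
    (hr : ¬ removed ε ((b, d) : Tri n)) :
    (st (Phi M b) d = 1 ∧ ∀ b', Nbr b d b' → hyp b d b' ∉ M) ∨
    (st (Phi M b) d = 0 ∧ ∃ b', Nbr b d b' ∧ hyp b d b' ∈ M) := by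
  obtain ⟨e, ⟨heM, hte⟩, hu⟩ := hM.2 (b, d) hr
  have t1 : ((b, d) : Tri n) ∈ leg b d := mem_leg.2 ⟨rfl, Or.inl rfl⟩
  have t2 : ((b, d) : Tri n) ∈ leg b (d + 3) := mem_leg.2 ⟨rfl, Or.inr rfl⟩
  have t3 : ∀ b', ((b, d) : Tri n) ∈ hyp b d b' := fun b' => Sym2.mem_mk_left _ _
  rw [st_eq_zero, st_eq_one]
  unfold Phi
  simp only [decide_eq_false_iff_not, decide_eq_true_eq]
  rcases (edge_cases (hM.1 _ heM) hte).2 with rfl | rfl | ⟨b', hb', rfl⟩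
  · left
    refine ⟨Or.inl ⟨heM, fun h => ?_⟩, fun b' hb' h => ?_⟩
    · exact d3_ne d (leg_inj (hu _ ⟨h, t2⟩)).2
    · exact leg_ne_hyp hb' (hu _ ⟨h, t3 _⟩).symm
  · left
    refine ⟨Or.inr ⟨fun h => ?_, heM⟩, fun b' hb' h => ?_⟩
    · exact d3_ne d (leg_inj (hu _ ⟨h, t1⟩)).2.symm
    · exact leg_ne_hyp hb' (hu _ ⟨h, t3 _⟩).symm
  · right
    refine ⟨⟨fun h => ?_, fun h => ?_⟩, b', hb', heM⟩
    · exact leg_ne_hyp hb' (hu _ ⟨h, t1⟩)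
    · exact leg_ne_hyp hb' (hu _ ⟨h, t2⟩)

lemma nbr_not_removed {b b' : Bk n} {d : Fin 4} (h : Nbr b d b') :
    ¬ removed ε ((b, d) : Tri n) := by
  rw [removed_iff]
  exact fun h2 => h2.2 ⟨b', h⟩

lemma ext_nbr {α : Type} (v : Bk n → Fin 4 → α) (o : ℤ → ℤ → α) {b b' : Bk n} {d : Fin 4}
    (h : Nbr b d b') (d' : Fin 4) :
    ext v o ((b.1 : ℕ) + dx d) ((b.2 : ℕ) + dy d) d' = v b' d' :=
  ext_in' _ _ b' d' h.1 h.2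

lemma ext_no_nbr (v : Bk n → Fin 4 → ℕ) {b : Bk n} {d : Fin 4}
    (h : ¬ ∃ b', Nbr b d b') (d' : Fin 4) :
    ext v (fun i j => (kap ε i j).toNat) ((b.1 : ℕ) + dx d) ((b.2 : ℕ) + dy d) d' =
      (!kb ε b).toNat := by
  rw [ext_out]
  · rw [kap_nb]; rfl
  · exact fun h2 => h (exists_bk h2)

lemma pm_cond (hM : IsPM (fortressGraph n ε) {t | ¬ removed ε t} M) :
    Cond n Req (fun b => st (Phi M b)) (fun i j => (kap ε i j).toNat) := by
  intro b d
  by_cases hb : ∃ b', Nbr b d b'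
  · obtain ⟨b', hb'⟩ := hb
    rw [ext_nbr _ _ hb']
    have h1 := pm_deg hM (nbr_not_removed (ε := ε) hb')
    have h2 := pm_deg hM (nbr_not_removed (ε := ε) hb'.symm)
    change st (Phi M b) d = st (Phi M b') (d + 2) ∧ st (Phi M b) d ≤ 1
    rcases h1 with ⟨h1, h1'⟩ | ⟨h1, c, hc, h1'⟩
    · rcases h2 with ⟨h2, h2'⟩ | ⟨h2, c', hc', h2'⟩
      · rw [h1, h2]; simp
      · exfalso
        have := hc'.uniq hb'.symm
        subst this
        rw [← hyp_symm] at h2'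
        exact h1' _ hb' h2'
    · have := hc.uniq hb'
      subst this
      rcases h2 with ⟨h2, h2'⟩ | ⟨h2, c', hc', h2'⟩
      · exfalso
        rw [hyp_symm] at h1'
        exact h2' _ hb'.symm h1'
      · rw [h1, h2]; simp
  · rw [ext_no_nbr _ hb]
    change st (Phi M b) d = (!kb ε b).toNat ∧ st (Phi M b) d ≤ 1
    by_cases hr : removed ε ((b, d) : Tri n)
    · rw [pm_removed hM hr]
      rw [removed_iff] at hr
      simp [hr.1]
    · rcases pm_deg hM hr with ⟨h1, _⟩ | ⟨_, b', hb', _⟩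
      · rw [removed_iff] at hr
        have : kb ε b = false := by
          cases hk : kb ε b
          · rfl
          · exact absurd ⟨hk, hb⟩ hr
        rw [h1, this]; simp
      · exact absurd ⟨b', hb'⟩ hb

lemma pm_sub {M' : Finset (Sym2 (Tri n))} (hM : IsPM (fortressGraph n ε) {t | ¬ removed ε t} M)
    (hM' : IsPM (fortressGraph n ε) {t | ¬ removed ε t} M') (h : Phi M = Phi M') : M ⊆ M' := by
  intro e he
  rcases edge_cases' (hM.1 _ he) with ⟨b, d, rfl⟩ | ⟨b, d, b', hb', rfl⟩
  · have := congrFun (congrFun h b) d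
    unfold Phi at this
    simpa [he] using this
  · rcases pm_deg hM (nbr_not_removed (ε := ε) hb') with ⟨_, h1⟩ | ⟨h1, _⟩
    · exact absurd he (h1 _ hb')
    · rcases pm_deg hM' (nbr_not_removed (ε := ε) hb') with ⟨h2, _⟩ | ⟨_, c, hc, h2⟩
      · rw [h] at h1; omega
      · rwa [hc.uniq hb'] at h2

open Classical in
noncomputable def Psi (X : Bk n → Fin 4 → Bool) : Finset (Sym2 (Tri n)) :=
  univ.filter fun e => (∃ b d, X b d = true ∧ e = leg b d) ∨
    ∃ b d b', Nbr b d b' ∧ st (X b) d = 0 ∧ e = hyp b d b'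

lemma mem_Psi {X : Bk n → Fin 4 → Bool} {e : Sym2 (Tri n)} : e ∈ Psi X ↔
    (∃ b d, X b d = true ∧ e = leg b d) ∨
    ∃ b d b', Nbr b d b' ∧ st (X b) d = 0 ∧ e = hyp b d b' := by
  unfold Psi; simp

lemma leg_mem_Psi {X : Bk n → Fin 4 → Bool} {b : Bk n} {d : Fin 4} :
    leg b d ∈ Psi X ↔ X b d = true := by
  rw [mem_Psi]
  constructor
  · rintro (⟨c, e, h, h2⟩ | ⟨c, e, c', h1, _, h2⟩)
    · obtain ⟨rfl, rfl⟩ := leg_inj h2; exact h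
    · exact absurd h2 (leg_ne_hyp h1)
  · intro h; exact Or.inl ⟨_, _, h, rfl⟩

lemma Phi_Psi (X : Bk n → Fin 4 → Bool) : Phi (Psi X) = X := by
  funext b d
  unfold Phi
  rw [Bool.eq_iff_iff, decide_eq_true_eq]
  exact leg_mem_Psi

lemma cond_removed {X : Bk n → Fin 4 → Bool}
    (hX : Cond n Req (fun b => st (X b)) (fun i j => (kap ε i j).toNat)) {b : Bk n} {d : Fin 4}
    (hr : removed ε ((b, d) : Tri n)) : st (X b) d = 0 := by
  rw [removed_iff] at hr
  have := (hX b d).1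
  rw [ext_no_nbr _ hr.2, hr.1] at this
  simpa using this

lemma cond_nbr {X : Bk n → Fin 4 → Bool}
    (hX : Cond n Req (fun b => st (X b)) (fun i j => (kap ε i j).toNat)) {b b' : Bk n} {d : Fin 4}
    (h : Nbr b d b') : st (X b) d = st (X b') (d + 2) := by
  have := (hX b d).1
  rwa [ext_nbr _ _ h] at this

lemma pm_Psi {X : Bk n → Fin 4 → Bool}
    (hX : Cond n Req (fun b => st (X b)) (fun i j => (kap ε i j).toNat)) :
    IsPM (fortressGraph n ε) {t | ¬ removed ε t} (Psi X) := by
  have hE : ∀ e ∈ Psi X, e ∈ (fortressGraph n ε).edgeSet := by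
    intro e he
    rcases mem_Psi.1 he with ⟨b, d, h, rfl⟩ | ⟨b, d, b', hb', _, rfl⟩
    · unfold leg
      rw [SimpleGraph.mem_edgeSet, adj_iff]
      refine ⟨fun hr => ?_, fun hr => ?_, Or.inl ⟨rfl, Or.inl rfl⟩⟩
      · have := (st_eq_zero.1 (cond_removed hX hr)).1
        rw [h] at this; cases this
      · have := (st_eq_zero.1 (cond_removed hX hr)).2
        rw [d13, h] at this; cases this
    · unfold hyp
      rw [SimpleGraph.mem_edgeSet, adj_iff]
      exact ⟨nbr_not_removed hb', nbr_not_removed hb'.symm, Or.inr ⟨hb', rfl⟩⟩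
  have hH : ∀ b d b', Nbr b d b' → hyp b d b' ∈ Psi X → st (X b) d = 0 := by
    intro b d b' hb' h
    rcases mem_Psi.1 h with ⟨c, e, _, h2⟩ | ⟨c, e, c', hc', h0, h2⟩
    · exact absurd h2.symm (leg_ne_hyp hb')
    · have : ((b, d) : Tri n) ∈ hyp c e c' := by rw [← h2]; exact Sym2.mem_mk_left _ _
      unfold hyp at this
      rw [Sym2.mem_iff, pair_eq, pair_eq] at this
      rcases this with ⟨rfl, rfl⟩ | ⟨rfl, rfl⟩
      · exact h0
      · rw [← cond_nbr hX hc']; exact h0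
  refine ⟨hE, ?_⟩
  rintro ⟨b, d⟩ hr
  change ¬ removed ε ((b, d) : Tri n) at hr
  have hle : st (X b) d ≤ 1 := (hX b d).2
  have t1 : ((b, d) : Tri n) ∈ leg b d := mem_leg.2 ⟨rfl, Or.inl rfl⟩
  have t2 : ((b, d) : Tri n) ∈ leg b (d + 3) := mem_leg.2 ⟨rfl, Or.inr rfl⟩
  have t3 : ∀ b', ((b, d) : Tri n) ∈ hyp b d b' := fun b' => Sym2.mem_mk_left _ _
  by_cases h0 : st (X b) d = 0
  · have hb : ∃ b', Nbr b d b' := by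
      by_contra hb
      apply hr
      rw [removed_iff]
      refine ⟨?_, hb⟩
      have := (hX b d).1
      rw [ext_no_nbr _ hb] at this
      change st (X b) d = _ at this
      rw [h0] at this
      cases hk : kb ε b
      · rw [hk] at this; simp at this
      · rfl
    obtain ⟨b', hb'⟩ := hb
    refine ⟨hyp b d b', ⟨mem_Psi.2 (Or.inr ⟨b, d, b', hb', h0, rfl⟩), t3 _⟩, ?_⟩
    rintro e ⟨he, hte⟩
    rw [st_eq_zero] at h0
    rcases (edge_cases (hE _ he) hte).2 with rfl | rfl | ⟨c, hc, rfl⟩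
    · rw [leg_mem_Psi, h0.1] at he; cases he
    · rw [leg_mem_Psi, h0.2] at he; cases he
    · rw [hc.uniq hb']
  · have h1 : st (X b) d = 1 := by omega
    rw [st_eq_one] at h1
    rcases h1 with ⟨h1, h2⟩ | ⟨h1, h2⟩
    · refine ⟨leg b d, ⟨leg_mem_Psi.2 h1, t1⟩, ?_⟩
      rintro e ⟨he, hte⟩
      rcases (edge_cases (hE _ he) hte).2 with rfl | rfl | ⟨c, hc, rfl⟩
      · rfl
      · rw [leg_mem_Psi, h2] at he; cases he
      · exact absurd (hH _ _ _ hc he) h0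
    · refine ⟨leg b (d + 3), ⟨leg_mem_Psi.2 h2, t2⟩, ?_⟩
      rintro e ⟨he, hte⟩
      rcases (edge_cases (hE _ he) hte).2 with rfl | rfl | ⟨c, hc, rfl⟩
      · rw [leg_mem_Psi, h1] at he; cases he
      · rfl
      · exact absurd (hH _ _ _ hc he) h0

end

lemma pm_count (n : ℕ) (ε : Bool) :
    (({M : Finset (Sym2 (Tri n)) | IsPM (fortressGraph n ε) {t | ¬ removed ε t} M}.ncard : ℕ) : ℚ)
      = G n ε := by
  rw [G_count]
  congr 1
  refine Set.ncard_congr (fun M _ => Phi M) ?_ ?_ ?_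
  · intro M hM
    exact pm_cond hM
  · intro M M' hM hM' h
    exact Finset.Subset.antisymm (pm_sub hM hM' h) (pm_sub hM' hM h.symm)
  · intro X hX
    exact ⟨Psi X, pm_Psi hX, Phi_Psi X⟩

end Fort


/-- **Yang's fortress theorem**: for every `n ≥ 1` and either of the two
alternating colorings, the number of perfect matchings of the fortress graph of
order `n` (equivalently, the number of diabolo-tilings of the fortress of order
`n`) is a power of `5` or twice a power of `5`. -/
theorem fortress_matching_count (n : ℕ) (hn : 1 ≤ n) (ε : Bool) :
    ∃ k : ℕ,
      {M : Finset (Sym2 (Tri n)) |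
          IsPM (fortressGraph n ε) {t | ¬ removed ε t} M}.ncard = 5 ^ k ∨
      {M : Finset (Sym2 (Tri n)) |
          IsPM (fortressGraph n ε) {t | ¬ removed ε t} M}.ncard = 2 * 5 ^ k := by
  obtain ⟨k, hk⟩ := Fort.G_val n ε
  rw [← Fort.pm_count] at hk
  exact ⟨k, by exact_mod_cast hk⟩
end
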